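/- Assume hypotheses (H), let λ_0 be a principal eigenvalue for the weight f_0, let λ_∞ be a principal eigenvalue for the weight f_∞ if f_∞>0 on [0,1] (λ_∞:=+∞ if f_∞≡0 and N=1), and assume λ_0<1<λ_∞. Then there exists exactly one nontrivial function u with u∈C^1([0,1],ℝ), φ_p∘u'∈C^1([0,1],ℝ), −(d/dr)(r^{N−1}φ_p(u'(r))) = r^{N−1} f(r,u(r)) for 0<r<1, and u'(0)=u(1)=0; moreover this u satisfies u(r)>0 for all r∈[0,1). -/

import Mathlib

open Set MeasureTheory Filter Topology intervalIntegral

noncomputable section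

/-- `phi p ξ = |ξ|^(p-2) ξ`, the function `φ_p`. -/
def phi (p ξ : ℝ) : ℝ := |ξ| ^ (p - 2) * ξ

/-- The (one-sided at endpoints) derivative of a function on `[0,1]`. -/
def deriv01 (u : ℝ → ℝ) (r : ℝ) : ℝ := derivWithin u (Set.Icc 0 1) r

/-- `u ∈ C^1([0,1],ℝ)`. -/
def C1on01 (u : ℝ → ℝ) : Prop :=
  (∀ r ∈ Set.Icc (0:ℝ) 1, DifferentiableWithinAt ℝ u (Set.Icc 0 1) r) ∧
  ContinuousOn (deriv01 u) (Set.Icc 0 1)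

/-- `J(h)(s) = ∫_0^s (t/s)^(N-1) h(t) dt`, with `J(h)(0) = 0`. -/
def Jmap (N : ℕ) (h : ℝ → ℝ) (s : ℝ) : ℝ :=
  if s = 0 then 0 else ∫ t in (0:ℝ)..s, (t / s) ^ (N - 1) * h t

/-- `S_p(h)(r) = ∫_r^1 φ_{p'}(J(h)(s)) ds` where `p' = p/(p-1)`. -/
def Sp (p : ℝ) (N : ℕ) (h : ℝ → ℝ) (r : ℝ) : ℝ :=
  ∫ s in r..(1:ℝ), phi (p / (p - 1)) (Jmap N h s)

/-- The sup norm over `[0,1]`. -/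
def norm0 (h : ℝ → ℝ) : ℝ := sSup ((fun t => |h t|) '' Set.Icc 0 1)

/-- `u` is not identically zero on `[0,1]`. -/
def Nontriv01 (u : ℝ → ℝ) : Prop := ∃ r ∈ Set.Icc (0:ℝ) 1, u r ≠ 0

/-- `(lam, u)` is a solution of problem (P):
`-(r^(N-1) φ_p(u'))' = lam r^(N-1) f(r, u(r))` on `(0,1)`, `u'(0) = u(1) = 0`. -/
def IsSolutionP (p : ℝ) (N : ℕ) (f : ℝ → ℝ → ℝ) (lam : ℝ) (u : ℝ → ℝ) : Prop :=
  C1on01 u ∧ C1on01 (fun r => phi p (deriv01 u r)) ∧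
  (∀ r ∈ Set.Ioo (0:ℝ) 1,
      HasDerivAt (fun s => s ^ (N - 1) * phi p (deriv01 u s))
        (-(lam * r ^ (N - 1) * f r (u r))) r) ∧
  deriv01 u 0 = 0 ∧ u 1 = 0

/-- `(lam, v)` is a principal eigenpair for the weight `w`. -/
def IsPrincipalEigenpair (p : ℝ) (N : ℕ) (w : ℝ → ℝ) (lam : ℝ) (v : ℝ → ℝ) : Prop :=
  0 < lam ∧ C1on01 v ∧ C1on01 (fun r => phi p (deriv01 v r)) ∧
  (∀ r ∈ Set.Ico (0:ℝ) 1, 0 < v r) ∧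
  (∀ r ∈ Set.Ioo (0:ℝ) 1,
      HasDerivAt (fun s => s ^ (N - 1) * phi p (deriv01 v s))
        (-(lam * r ^ (N - 1) * w r * phi p (v r))) r) ∧
  deriv01 v 0 = 0 ∧ v 1 = 0

/-- Hypotheses (H) of the paper: (H1)–(H6), with `f₂ = ∂₂f` and asymptotes `f0`, `finf`. -/
structure HypH (p : ℝ) (N : ℕ) (f f₂ : ℝ → ℝ → ℝ) (f0 finf : ℝ → ℝ) : Prop where
  hp : 2 < p
  hN : 1 ≤ N
  hf_cont : ContinuousOn (fun q : ℝ × ℝ => f q.1 q.2) (Set.Icc 0 1 ×ˢ Set.univ)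
  hf_deriv : ∀ r ∈ Set.Icc (0:ℝ) 1, ∀ ξ : ℝ, HasDerivAt (fun t => f r t) (f₂ r ξ) ξ
  hf₂_cont : ContinuousOn (fun q : ℝ × ℝ => f₂ q.1 q.2) (Set.Icc 0 1 ×ˢ Set.univ)
  hH2 : ∀ r ∈ Set.Icc (0:ℝ) 1, ∀ ξ : ℝ, ξ ≠ 0 → 0 < f r ξ
  hf_zero : ∀ r ∈ Set.Icc (0:ℝ) 1, f r 0 = 0
  hH3 : ∀ r ∈ Set.Icc (0:ℝ) 1, ∀ ξ : ℝ, 0 ≤ ξ → f₂ r ξ * ξ ≤ (p - 1) * f r ξ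
  hH3s : ∃ δ > 0, ∃ ε > 0, ∀ r ∈ Set.Ioc (1 - δ) 1, ∀ ξ ∈ Set.Ioo (0:ℝ) ε,
      f₂ r ξ * ξ < (p - 1) * f r ξ
  hf0_cont : ContinuousOn f0 (Set.Icc 0 1)
  hfinf_cont : ContinuousOn finf (Set.Icc 0 1)
  hH4a : ∀ e > 0, ∃ d > 0, ∀ ξ ∈ Set.Ioo (0:ℝ) d, ∀ r ∈ Set.Icc (0:ℝ) 1,
      |f r ξ / phi p ξ - f0 r| < e
  hH4b : ∀ e > 0, ∃ d > 0, ∀ ξ ∈ Set.Ioo (0:ℝ) d, ∀ r ∈ Set.Icc (0:ℝ) 1,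
      |f₂ r ξ / ξ ^ (p - 2) - (p - 1) * f0 r| < e
  hH5 : ∀ e > 0, ∃ M : ℝ, ∀ ξ : ℝ, M ≤ ξ → ∀ r ∈ Set.Icc (0:ℝ) 1,
      |f r ξ / phi p ξ - finf r| < e
  hH6 : (∀ r ∈ Set.Icc (0:ℝ) 1, 0 < finf r) ∨ (N = 1 ∧ ∀ r ∈ Set.Icc (0:ℝ) 1, finf r = 0)

/-- The Young defect `a^p - p a b^(p-1) + (p-1) b^p`. -/
def youngDefect (p a b : ℝ) : ℝ := a ^ p - p * b ^ (p - 1) * a + (p - 1) * b ^ p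

lemma youngDefect_eq {p a b : ℝ} (ha : 0 ≤ a) (hb : 0 < b) :
    youngDefect p a b = b ^ p * ((1 + (a / b - 1)) ^ p - (1 + p * (a / b - 1))) := by
  have h1 : (1 + (a / b - 1)) = a / b := by ring
  have h2 : b ^ p = b ^ (p - 1) * b := by
    rw [← Real.rpow_add_one hb.ne']; congr 1; ring
  have h3 : b ^ p ≠ 0 := (Real.rpow_pos_of_pos hb p).ne'
  rw [h1, Real.div_rpow ha hb.le]
  have h4 : b ^ p * (a ^ p / b ^ p - (1 + p * (a / b - 1)))
      = a ^ p - b ^ p * (1 + p * (a / b - 1)) := by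
    field_simp
  rw [h4, youngDefect, h2]
  field_simp
  ring

lemma youngDefect_nonneg {p a b : ℝ} (hp : 2 < p) (ha : 0 ≤ a) (hb : 0 ≤ b) :
    0 ≤ youngDefect p a b := by
  rcases hb.eq_or_lt with rfl | hb
  · have h1 : (0 : ℝ) ^ (p - 1) = 0 := Real.zero_rpow (by linarith)
    have h2 : (0 : ℝ) ^ p = 0 := Real.zero_rpow (by linarith)
    simp only [youngDefect, h1, h2]
    have := Real.rpow_nonneg ha p
    linarith
  · rw [youngDefect_eq ha hb]
    have h := one_add_mul_self_le_rpow_one_add (s := a / b - 1) (p := p)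
      (by have : 0 ≤ a / b := by positivity
          linarith) (by linarith)
    have := (Real.rpow_pos_of_pos hb p).le
    exact mul_nonneg this (by linarith)

lemma eq_of_youngDefect_nonpos {p a b : ℝ} (hp : 2 < p) (ha : 0 ≤ a) (hb : 0 ≤ b)
    (h : youngDefect p a b ≤ 0) : a = b := by
  rcases hb.eq_or_lt with rfl | hb
  · have h1 : (0 : ℝ) ^ (p - 1) = 0 := Real.zero_rpow (by linarith)
    have h2 : (0 : ℝ) ^ p = 0 := Real.zero_rpow (by linarith)
    simp only [youngDefect, h1, h2] at h
    by_contra hne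
    have := Real.rpow_pos_of_pos (lt_of_le_of_ne ha (Ne.symm hne)) p
    linarith
  · by_contra hne
    rw [youngDefect_eq ha hb] at h
    have hs : a / b - 1 ≠ 0 := by
      intro h0
      apply hne
      have : a / b = 1 := by linarith
      field_simp at this
      exact this
    have h' := one_add_mul_self_lt_rpow_one_add (s := a / b - 1) (p := p)
      (by have : 0 ≤ a / b := by positivity
          linarith) hs (by linarith)
    have := mul_pos (Real.rpow_pos_of_pos hb p) (sub_pos.2 h')
    linarith

/-- A nonincreasing function `u` on `[0,1]` with slope `-q` whose flux `s^(N-1) q^(p-1)` has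
derivative `s^(N-1) g`. -/
structure RadialFlow (p : ℝ) (N : ℕ) (u q g : ℝ → ℝ) : Prop where
  cont : ContinuousOn u (Icc 0 1)
  hasDeriv : ∀ r ∈ Ioo (0:ℝ) 1, HasDerivAt u (-(q r)) r
  slope_cont : ContinuousOn q (Icc 0 1)
  slope_nonneg : ∀ r ∈ Icc (0:ℝ) 1, 0 ≤ q r
  slope_zero : q 0 = 0
  hasDeriv_flux : ∀ r ∈ Ioo (0:ℝ) 1,
    HasDerivAt (fun s => s ^ (N - 1) * q s ^ (p - 1)) (r ^ (N - 1) * g r) r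

lemma picone_hasDerivAt {p : ℝ} {N : ℕ} (hp : 2 < p) {u v qu qv gu gv : ℝ → ℝ}
    (hu : RadialFlow p N u qu gu) (hv : RadialFlow p N v qv gv) {r : ℝ}
    (hr : r ∈ Ioo (0:ℝ) 1) (hur : 0 < u r) (hvr : 0 ≤ v r) :
    HasDerivAt (fun s => (s ^ (N - 1) * qu s ^ (p - 1)) * (v s ^ p / u s ^ (p - 1)) -
        v s * (s ^ (N - 1) * qv s ^ (p - 1)))
      (r ^ (N - 1) * (gu r * (v r ^ p / u r ^ (p - 1)) - v r * gv r +
        youngDefect p (qv r) (v r / u r * qu r))) r := by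
  have hr' : r ∈ Icc (0:ℝ) 1 := ⟨hr.1.le, hr.2.le⟩
  have hqu := hu.slope_nonneg r hr'
  have hqv := hv.slope_nonneg r hr'
  have h1 : HasDerivAt (fun s => v s ^ p) (-(qv r) * p * v r ^ (p - 1)) r :=
    (hv.hasDeriv r hr).rpow_const (Or.inr (by linarith))
  have h2 : HasDerivAt (fun s => u s ^ (p - 1)) (-(qu r) * (p - 1) * u r ^ (p - 1 - 1)) r :=
    (hu.hasDeriv r hr).rpow_const (Or.inl hur.ne')
  have hd := ((hu.hasDeriv_flux r hr).mul
    (h1.div h2 (Real.rpow_pos_of_pos hur _).ne')).sub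
      ((hv.hasDeriv r hr).mul (hv.hasDeriv_flux r hr))
  refine hd.congr_deriv ?_
  have e1 : (v r / u r * qu r) ^ (p - 1) = v r ^ (p - 1) / u r ^ (p - 1) * qu r ^ (p - 1) := by
    rw [Real.mul_rpow (by positivity) hqu, Real.div_rpow hvr hur.le]
  have key : ∀ x : ℝ, 0 ≤ x → x ^ p = x ^ (p - 1) * x := by
    intro x hx
    rcases hx.eq_or_lt with rfl | hx
    · rw [Real.zero_rpow (by linarith), mul_zero]
    · rw [← Real.rpow_add_one hx.ne']; congr 1; ring
  have e2 : u r ^ (p - 1 - 1) = u r ^ (p - 1) / u r := by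
    rw [Real.rpow_sub_one hur.ne']
  have hU := (Real.rpow_pos_of_pos hur (p - 1)).ne'
  simp only [Pi.div_apply]
  rw [youngDefect, key _ hqv, key _ (show 0 ≤ v r / u r * qu r by positivity), e1, e2, key _ hvr]
  generalize u r ^ (p - 1) = U at *
  field_simp
  ring

namespace RadialFlow

variable {p : ℝ} {N : ℕ} {u q g : ℝ → ℝ}

lemma antitoneOn (h : RadialFlow p N u q g) : AntitoneOn u (Icc 0 1) := by
  refine antitoneOn_of_deriv_nonpos (convex_Icc 0 1) h.cont ?_ ?_
  · rw [interior_Icc]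
    exact fun r hr => (h.hasDeriv r hr).differentiableAt.differentiableWithinAt
  · rw [interior_Icc]
    intro r hr
    rw [(h.hasDeriv r hr).deriv]
    have := h.slope_nonneg r ⟨hr.1.le, hr.2.le⟩
    linarith

lemma flux_continuousOn (hp : 2 < p) (h : RadialFlow p N u q g) :
    ContinuousOn (fun s => s ^ (N - 1) * q s ^ (p - 1)) (Icc 0 1) :=
  (continuous_pow _).continuousOn.mul
    (h.slope_cont.rpow_const fun _ _ => Or.inr (by linarith))

lemma flux_zero (hp : 2 < p) (h : RadialFlow p N u q g) :
    (0 : ℝ) ^ (N - 1) * q 0 ^ (p - 1) = 0 := by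
  rw [h.slope_zero, Real.zero_rpow (by linarith), mul_zero]

lemma flux_monotoneOn (hp : 2 < p) (h : RadialFlow p N u q g)
    (hg : ∀ r ∈ Ioo (0:ℝ) 1, 0 ≤ g r) :
    MonotoneOn (fun s => s ^ (N - 1) * q s ^ (p - 1)) (Icc 0 1) := by
  refine monotoneOn_of_deriv_nonneg (convex_Icc 0 1) (h.flux_continuousOn hp) ?_ ?_
  · rw [interior_Icc]
    exact fun r hr => (h.hasDeriv_flux r hr).differentiableAt.differentiableWithinAt
  · rw [interior_Icc]
    intro r hr
    rw [(h.hasDeriv_flux r hr).deriv]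
    exact mul_nonneg (pow_nonneg hr.1.le _) (hg r hr)

lemma slope_le (hp : 2 < p) (hN : 1 ≤ N) (h : RadialFlow p N u q g) {B : ℝ} (hB : 0 ≤ B)
    (hg : ∀ r ∈ Ioo (0:ℝ) 1, g r ≤ B ^ (p - 1)) {r : ℝ} (hr : r ∈ Icc (0:ℝ) 1) : q r ≤ B := by
  rcases hr.1.eq_or_lt with rfl | hr0
  · rw [h.slope_zero]; exact hB
  have hBp : 0 ≤ B ^ (p - 1) := Real.rpow_nonneg hB _
  have hmono : AntitoneOn (fun s => s ^ (N - 1) * q s ^ (p - 1) - B ^ (p - 1) * s ^ N)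
      (Icc 0 1) := by
    refine antitoneOn_of_deriv_nonpos (convex_Icc 0 1)
      ((h.flux_continuousOn hp).sub (by fun_prop)) ?_ ?_
    · rw [interior_Icc]
      exact fun s hs => ((h.hasDeriv_flux s hs).differentiableAt.sub
        (by fun_prop)).differentiableWithinAt
    · rw [interior_Icc]
      intro s hs
      have hd : HasDerivAt (fun s => s ^ (N - 1) * q s ^ (p - 1) - B ^ (p - 1) * s ^ N)
          (s ^ (N - 1) * g s - B ^ (p - 1) * (N * s ^ (N - 1))) s :=
        (h.hasDeriv_flux s hs).sub ((hasDerivAt_pow N s).const_mul _)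
      rw [hd.deriv]
      have h1 : (1 : ℝ) ≤ N := by exact_mod_cast hN
      have h2 : 0 ≤ s ^ (N - 1) := pow_nonneg hs.1.le _
      have h3 := mul_le_mul_of_nonneg_left (hg s hs) h2
      have h4 := mul_nonneg hBp h2
      nlinarith
  have h0 := hmono (left_mem_Icc.2 zero_le_one) hr hr.1
  have h00 := h.flux_zero hp
  simp only [h00, zero_pow (by omega : N ≠ 0)] at h0
  have hpow : r ^ N = r ^ (N - 1) * r := by
    rw [← pow_succ]; congr 1; omega
  have hrp : 0 < r ^ (N - 1) := pow_pos hr0 _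
  have h1 : q r ^ (p - 1) ≤ B ^ (p - 1) * r := by
    rw [hpow] at h0
    refine le_of_mul_le_mul_left ?_ hrp
    linarith
  have h2 : q r ^ (p - 1) ≤ B ^ (p - 1) := h1.trans (by nlinarith [hr.2])
  exact (Real.rpow_le_rpow_iff (h.slope_nonneg r hr) hB (by linarith)).1 h2

lemma sub_mul_le (hp : 2 < p) (hN : 1 ≤ N) (h : RadialFlow p N u q g) {B : ℝ} (hB : 0 ≤ B)
    (hg : ∀ r ∈ Ioo (0:ℝ) 1, g r ≤ B ^ (p - 1)) {r : ℝ} (hr : r ∈ Icc (0:ℝ) 1) :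
    u 0 - B * r ≤ u r := by
  have hmono : MonotoneOn (fun s => u s + B * s) (Icc 0 1) := by
    refine monotoneOn_of_deriv_nonneg (convex_Icc 0 1) (h.cont.add (by fun_prop)) ?_ ?_
    · rw [interior_Icc]
      exact fun s hs => ((h.hasDeriv s hs).differentiableAt.add
        (by fun_prop)).differentiableWithinAt
    · rw [interior_Icc]
      intro s hs
      have hd : HasDerivAt (fun s => u s + B * s) (-(q s) + B * 1) s :=
        (h.hasDeriv s hs).add ((hasDerivAt_id s).const_mul _)
      rw [hd.deriv]
      have := h.slope_le hp hN hB hg (r := s) ⟨hs.1.le, hs.2.le⟩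
      linarith
  have := hmono (left_mem_Icc.2 zero_le_one) hr hr.1
  simp only [mul_zero, add_zero] at this
  linarith

/-- If the flux vanishes at `r > 0` then `u` is constant on `[0,r]`. -/
lemma eq_of_flux_nonpos (hp : 2 < p) (h : RadialFlow p N u q g)
    (hg : ∀ r ∈ Ioo (0:ℝ) 1, 0 ≤ g r) {r : ℝ} (hr : r ∈ Icc (0:ℝ) 1)
    (hflux : r ^ (N - 1) * q r ^ (p - 1) ≤ 0) : u r = u 0 := by
  have hq : ∀ s ∈ Ioo 0 r, q s = 0 := by
    intro s hs
    have hs1 : s ∈ Icc (0:ℝ) 1 := ⟨hs.1.le, hs.2.le.trans hr.2⟩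
    have h1 := (h.flux_monotoneOn hp hg hs1 hr hs.2.le).trans hflux
    by_contra hne
    have := lt_of_le_of_ne (h.slope_nonneg s hs1) (Ne.symm hne)
    have := mul_pos (pow_pos hs.1 (N - 1)) (Real.rpow_pos_of_pos this (p - 1))
    linarith
  have hsub : Icc 0 r ⊆ Icc (0:ℝ) 1 := Icc_subset_Icc_right hr.2
  refine le_antisymm (h.antitoneOn (left_mem_Icc.2 zero_le_one) hr hr.1) ?_
  refine monotoneOn_of_deriv_nonneg (convex_Icc 0 r) (h.cont.mono hsub) ?_ ?_
    (left_mem_Icc.2 hr.1) (right_mem_Icc.2 hr.1) hr.1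
  · rw [interior_Icc]
    exact fun s hs => (h.hasDeriv s
      ⟨hs.1, hs.2.trans_le hr.2⟩).differentiableAt.differentiableWithinAt
  · rw [interior_Icc]
    intro s hs
    rw [(h.hasDeriv s ⟨hs.1, hs.2.trans_le hr.2⟩).deriv, hq s hs, neg_zero]

lemma pos (hp : 2 < p) (h : RadialFlow p N u q g) (hg : ∀ r ∈ Ioo (0:ℝ) 1, 0 ≤ g r)
    (h0 : 0 < u 0) (h1 : u 1 = 0) {r : ℝ} (hr : r ∈ Ico (0:ℝ) 1) : 0 < u r := by
  by_contra! hneg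
  have hr0 : 0 < r := by
    rcases hr.1.eq_or_lt with rfl | h'
    · linarith
    · exact h'
  have hmem : ∀ s ∈ Ioo r 1, s ∈ Icc (0:ℝ) 1 := fun s hs => ⟨(hr0.trans hs.1).le, hs.2.le⟩
  have hzero : ∀ s ∈ Ioo r 1, u s = 0 := fun s hs => le_antisymm
    ((h.antitoneOn ⟨hr.1, hr.2.le⟩ (hmem s hs) hs.1.le).trans hneg)
    (h1 ▸ h.antitoneOn (hmem s hs) (right_mem_Icc.2 zero_le_one) hs.2.le)
  obtain ⟨s, hs⟩ := exists_between hr.2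
  have hqs : q s = 0 := by
    have hd := h.hasDeriv s ⟨hr0.trans hs.1, hs.2⟩
    have hd' : HasDerivAt u 0 s := (hasDerivAt_const s (0:ℝ)).congr_of_eventuallyEq
      (by filter_upwards [Ioo_mem_nhds hs.1 hs.2] with x hx using hzero x hx)
    have := hd.unique hd'
    linarith
  have := h.eq_of_flux_nonpos hp hg (hmem s hs)
    (by rw [hqs, Real.zero_rpow (by linarith), mul_zero])
  rw [hzero s hs] at this
  linarith

/-- A positive decreasing profile vanishing at `1` does so at least linearly. -/
lemma exists_linear_lower_bound (hp : 2 < p) (h : RadialFlow p N u q g)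
    (hg : ∀ r ∈ Ioo (0:ℝ) 1, 0 ≤ g r) (h0 : 0 < u 0) (h1 : u 1 = 0) :
    ∃ k > 0, ∃ a ∈ Ico (0:ℝ) 1, ∀ r ∈ Icc a 1, k * (1 - r) ≤ u r := by
  have hflux : 0 < (1:ℝ) ^ (N - 1) * q 1 ^ (p - 1) := by
    by_contra! hle
    have := h.eq_of_flux_nonpos hp hg (right_mem_Icc.2 zero_le_one) hle
    linarith
  have hq1 : 0 < q 1 := by
    by_contra! hle
    have := le_antisymm hle (h.slope_nonneg 1 (right_mem_Icc.2 zero_le_one))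
    rw [this, Real.zero_rpow (by linarith), mul_zero] at hflux
    exact lt_irrefl _ hflux
  have hev : ∀ᶠ s in 𝓝[Icc 0 1] (1:ℝ), q 1 / 2 < q s :=
    (h.slope_cont 1 (right_mem_Icc.2 zero_le_one)).eventually (lt_mem_nhds (by linarith))
  rw [eventually_nhdsWithin_iff, Metric.eventually_nhds_iff] at hev
  obtain ⟨ε, hε, hev⟩ := hev
  have ha : max 0 (1 - ε / 2) < 1 := max_lt one_pos (by linarith)
  refine ⟨q 1 / 2, by linarith, max 0 (1 - ε / 2), ⟨le_max_left _ _, ha⟩, ?_⟩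
  have hsub : Icc (max 0 (1 - ε / 2)) 1 ⊆ Icc (0:ℝ) 1 := Icc_subset_Icc_left (le_max_left _ _)
  have hmono : AntitoneOn (fun s => u s + q 1 / 2 * s) (Icc (max 0 (1 - ε / 2)) 1) := by
    refine antitoneOn_of_deriv_nonpos (convex_Icc _ _)
      ((h.cont.mono hsub).add (by fun_prop)) ?_ ?_
    · rw [interior_Icc]
      exact fun s hs => ((h.hasDeriv s ⟨(le_max_left _ _).trans_lt hs.1, hs.2⟩).differentiableAt.add
        (by fun_prop)).differentiableWithinAt
    · rw [interior_Icc]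
      intro s hs
      have hs0 : s ∈ Ioo (0:ℝ) 1 := ⟨(le_max_left _ _).trans_lt hs.1, hs.2⟩
      have hd : HasDerivAt (fun s => u s + q 1 / 2 * s) (-(q s) + q 1 / 2 * 1) s :=
        (h.hasDeriv s hs0).add ((hasDerivAt_id s).const_mul _)
      rw [hd.deriv]
      have hs1 : 1 - ε / 2 < s := (le_max_right _ _).trans_lt hs.1
      have := hev (y := s) (by
        rw [Real.dist_eq, abs_sub_lt_iff]
        constructor <;> linarith [hs.2]) ⟨hs0.1.le, hs0.2.le⟩
      linarith
  intro r hr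
  have := hmono hr (right_mem_Icc.2 ha.le) hr.2
  simp only [h1] at this
  linarith

end RadialFlow

lemma phi_neg_of_nonneg {p x : ℝ} (hp : 2 < p) (hx : 0 ≤ x) : phi p (-x) = -(x ^ (p - 1)) := by
  rw [phi, abs_neg, abs_of_nonneg hx]
  rcases hx.eq_or_lt with rfl | hx
  · rw [Real.zero_rpow (by linarith : p - 1 ≠ 0)]; simp
  · rw [mul_neg, ← Real.rpow_add_one hx.ne']
    congr 2; ring

lemma phi_of_nonneg {p x : ℝ} (hp : 2 < p) (hx : 0 ≤ x) : phi p x = x ^ (p - 1) := by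
  have h := phi_neg_of_nonneg hp hx
  rw [phi, abs_neg, mul_neg, neg_inj] at h
  exact h

lemma continuous_phi {p : ℝ} (hp : 2 < p) : Continuous (phi p) :=
  ((Real.continuous_rpow_const (by linarith)).comp continuous_abs).mul continuous_id

lemma C1on01.continuousOn {u : ℝ → ℝ} (h : C1on01 u) : ContinuousOn u (Icc 0 1) :=
  fun r hr => (h.1 r hr).continuousWithinAt

/-- `C^1` radial profiles with nonnegative source are `RadialFlow`s. -/
lemma C1on01.radialFlow {p : ℝ} {N : ℕ} {u g : ℝ → ℝ} (hp : 2 < p) (hu : C1on01 u)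
    (hd : ∀ r ∈ Ioo (0:ℝ) 1,
      HasDerivAt (fun s => s ^ (N - 1) * phi p (deriv01 u s)) (-(r ^ (N - 1) * g r)) r)
    (h0 : deriv01 u 0 = 0) (hg : ∀ r ∈ Ioo (0:ℝ) 1, 0 ≤ g r) :
    RadialFlow p N u (fun r => -(deriv01 u r)) g := by
  have hcont : ContinuousOn (fun s => s ^ (N - 1) * phi p (deriv01 u s)) (Icc 0 1) :=
    (continuous_pow _).continuousOn.mul ((continuous_phi hp).comp_continuousOn hu.2)
  have hanti : AntitoneOn (fun s => s ^ (N - 1) * phi p (deriv01 u s)) (Icc 0 1) := by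
    refine antitoneOn_of_deriv_nonpos (convex_Icc 0 1) hcont ?_ ?_
    · rw [interior_Icc]
      exact fun r hr => (hd r hr).differentiableAt.differentiableWithinAt
    · rw [interior_Icc]
      intro r hr
      rw [(hd r hr).deriv]
      have := mul_nonneg (pow_nonneg hr.1.le (N - 1)) (hg r hr)
      linarith
  have hnonneg : ∀ r ∈ Icc (0:ℝ) 1, 0 ≤ -(deriv01 u r) := by
    intro r hr
    rcases hr.1.eq_or_lt with rfl | hr0
    · rw [h0, neg_zero]
    by_contra! hneg
    have hpos : 0 < deriv01 u r := by linarith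
    have h1 := hanti (left_mem_Icc.2 zero_le_one) hr hr.1
    simp only [h0, phi_of_nonneg hp le_rfl, Real.zero_rpow (by linarith : p - 1 ≠ 0), mul_zero,
      phi_of_nonneg hp hpos.le] at h1
    have := mul_pos (pow_pos hr0 (N - 1)) (Real.rpow_pos_of_pos hpos (p - 1))
    linarith
  refine ⟨hu.continuousOn, ?_, hu.2.neg, hnonneg, by simp [h0], ?_⟩
  · intro r hr
    rw [neg_neg]
    exact (hu.1 r ⟨hr.1.le, hr.2.le⟩).hasDerivWithinAt.hasDerivAt (Icc_mem_nhds hr.1 hr.2)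
  · intro r hr
    have h1 := (hd r hr).neg
    rw [neg_neg] at h1
    refine h1.congr_of_eventuallyEq ?_
    filter_upwards [Icc_mem_nhds hr.1 hr.2] with s hs
    have := phi_neg_of_nonneg hp (hnonneg s hs)
    rw [neg_neg] at this
    simp only [Pi.neg_apply, this]
    ring

namespace HypH

variable {p : ℝ} {N : ℕ} {f f₂ : ℝ → ℝ → ℝ} {f0 finf : ℝ → ℝ}

lemma nonneg (H : HypH p N f f₂ f0 finf) {r : ℝ} (hr : r ∈ Icc (0:ℝ) 1) (ξ : ℝ) : 0 ≤ f r ξ := by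
  by_cases h : ξ = 0
  · rw [h, H.hf_zero r hr]
  · exact (H.hH2 r hr ξ h).le

lemma ratio_hasDerivAt (H : HypH p N f f₂ f0 finf) {r ξ : ℝ} (hr : r ∈ Icc (0:ℝ) 1)
    (hξ : 0 < ξ) : HasDerivAt (fun t => f r t / t ^ (p - 1))
      ((f₂ r ξ * ξ - (p - 1) * f r ξ) / ξ ^ p) ξ := by
  have h := (H.hf_deriv r hr ξ).div
    (Real.hasDerivAt_rpow_const (p := p - 1) (Or.inl hξ.ne')) (Real.rpow_pos_of_pos hξ _).ne'
  refine h.congr_deriv ?_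
  have e1 : ξ ^ p = ξ ^ (p - 1) * ξ := by
    rw [← Real.rpow_add_one hξ.ne']; congr 1; ring
  have e2 : ξ ^ (p - 1 - 1) = ξ ^ (p - 1) / ξ := Real.rpow_sub_one hξ.ne' _
  have hU := (Real.rpow_pos_of_pos hξ (p - 1)).ne'
  rw [e1, e2]
  field_simp

lemma ratio_antitoneOn (H : HypH p N f f₂ f0 finf) {r : ℝ} (hr : r ∈ Icc (0:ℝ) 1) :
    AntitoneOn (fun t => f r t / t ^ (p - 1)) (Ioi 0) := by
  refine antitoneOn_of_deriv_nonpos (convex_Ioi 0)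
    (fun ξ hξ => (H.ratio_hasDerivAt hr hξ).continuousAt.continuousWithinAt) ?_ ?_
  · rw [interior_Ioi]
    exact fun ξ hξ => (H.ratio_hasDerivAt hr hξ).differentiableAt.differentiableWithinAt
  · rw [interior_Ioi]
    intro ξ hξ
    rw [(H.ratio_hasDerivAt hr hξ).deriv]
    exact div_nonpos_of_nonpos_of_nonneg (sub_nonpos.2 (H.hH3 r hr ξ (le_of_lt hξ)))
      (Real.rpow_nonneg (le_of_lt hξ) _)

lemma exists_ratio_strictAntiOn (H : HypH p N f f₂ f0 finf) :
    ∃ δ > 0, ∃ ε > 0, ∀ r ∈ Icc (0:ℝ) 1, 1 - δ < r →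
      StrictAntiOn (fun t => f r t / t ^ (p - 1)) (Ioo 0 ε) := by
  obtain ⟨δ, hδ, ε, hε, h⟩ := H.hH3s
  refine ⟨δ, hδ, ε, hε, fun r hr hrδ => ?_⟩
  refine strictAntiOn_of_deriv_neg (convex_Ioo 0 ε)
    (fun ξ hξ => (H.ratio_hasDerivAt hr hξ.1).continuousAt.continuousWithinAt) ?_
  rw [interior_Ioo]
  intro ξ hξ
  rw [(H.ratio_hasDerivAt hr hξ.1).deriv]
  exact div_neg_of_neg_of_pos (sub_neg.2 (h r ⟨hrδ, hr.2⟩ ξ hξ)) (Real.rpow_pos_of_pos hξ.1 _)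

lemma ratio_le (H : HypH p N f f₂ f0 finf) {r ξ : ℝ} (hr : r ∈ Icc (0:ℝ) 1) (hξ : 0 < ξ) :
    f r ξ / ξ ^ (p - 1) ≤ f0 r := by
  refine le_of_forall_pos_le_add fun e he => ?_
  obtain ⟨d, hd, h⟩ := H.hH4a e he
  have hη : 0 < min ξ (d / 2) := lt_min hξ (by linarith)
  have h1 := h _ ⟨hη, (min_le_right _ _).trans_lt (by linarith)⟩ r hr
  rw [phi_of_nonneg H.hp hη.le, abs_lt] at h1
  have h2 := H.ratio_antitoneOn hr (mem_Ioi.2 hη) (mem_Ioi.2 hξ) (min_le_left _ _)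
  simp only at h2
  linarith

lemma le_mul_rpow (H : HypH p N f f₂ f0 finf) {r ξ : ℝ} (hr : r ∈ Icc (0:ℝ) 1) (hξ : 0 ≤ ξ) :
    f r ξ ≤ f0 r * ξ ^ (p - 1) := by
  rcases hξ.eq_or_lt with rfl | hξ
  · have hp := H.hp
    rw [H.hf_zero r hr, Real.zero_rpow (by linarith), mul_zero]
  · exact (div_le_iff₀ (Real.rpow_pos_of_pos hξ _)).1 (H.ratio_le hr hξ)

lemma f0_pos (H : HypH p N f f₂ f0 finf) {r : ℝ} (hr : r ∈ Icc (0:ℝ) 1) : 0 < f0 r :=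
  (div_pos (H.hH2 r hr 1 one_ne_zero) (Real.rpow_pos_of_pos one_pos _)).trans_le
    (H.ratio_le hr one_pos)

end HypH

lemma IsPrincipalEigenpair.radialFlow {p : ℝ} {N : ℕ} {w v : ℝ → ℝ} {lam : ℝ} (hp : 2 < p)
    (hw : ∀ r ∈ Icc (0:ℝ) 1, 0 ≤ w r) (h : IsPrincipalEigenpair p N w lam v) :
    RadialFlow p N v (fun r => -(deriv01 v r)) (fun r => lam * w r * v r ^ (p - 1)) := by
  obtain ⟨hlam, hv, -, hpos, hd, h0, -⟩ := h
  refine hv.radialFlow hp (fun r hr => ?_) h0 (fun r hr => ?_)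
  · have := hd r hr
    rw [phi_of_nonneg hp (hpos r ⟨hr.1.le, hr.2⟩).le] at this
    exact this.congr_deriv (by ring)
  · have h1 := hw r ⟨hr.1.le, hr.2.le⟩
    have h2 := Real.rpow_nonneg (hpos r ⟨hr.1.le, hr.2⟩).le (p - 1)
    positivity

/-- The Picone function is continuous where the denominator does not vanish. -/
lemma picone_continuousOn {p : ℝ} {N : ℕ} (hp : 2 < p) {u v qu qv gu gv : ℝ → ℝ}
    (hu : RadialFlow p N u qu gu) (hv : RadialFlow p N v qv gv) {s : Set ℝ} (hs : s ⊆ Icc 0 1)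
    (hpos : ∀ r ∈ s, 0 < u r) :
    ContinuousOn (fun s => (s ^ (N - 1) * qu s ^ (p - 1)) * (v s ^ p / u s ^ (p - 1)) -
        v s * (s ^ (N - 1) * qv s ^ (p - 1))) s := by
  refine (((hu.flux_continuousOn hp).mono hs).mul
    (((hv.cont.mono hs).rpow_const fun _ _ => Or.inr (by linarith)).div
      ((hu.cont.mono hs).rpow_const fun r hr => Or.inl (hpos r hr).ne') fun r hr =>
        (Real.rpow_pos_of_pos (hpos r hr) _).ne')).sub
    ((hv.cont.mono hs).mul ((hv.flux_continuousOn hp).mono hs))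

lemma exists_small_shooting {p : ℝ} {N : ℕ} {f f₂ : ℝ → ℝ → ℝ} {f0 finf : ℝ → ℝ}
    (H : HypH p N f f₂ f0 finf) {lam : ℝ} (hlam : ∃ v, IsPrincipalEigenpair p N f0 lam v)
    (hlt : lam < 1) :
    ∃ d₀ > 0, ∀ u q : ℝ → ℝ, RadialFlow p N u q (fun r => f r (max (u r) 0)) →
      u 0 < d₀ → u 1 ≤ 0 := by
  obtain ⟨v, hv⟩ := hlam
  have hp := H.hp
  obtain ⟨a, ha, hmin⟩ := isCompact_Icc.exists_isMinOn (nonempty_Icc.2 zero_le_one) H.hf0_cont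
  have hc : 0 < f0 a := H.f0_pos ha
  obtain ⟨d, hd, hclose⟩ := H.hH4a ((1 - lam) * f0 a) (mul_pos (by linarith) hc)
  refine ⟨d, hd, fun u q hu hu0 => ?_⟩
  by_contra! hu1
  have hpos : ∀ r ∈ Icc (0:ℝ) 1, 0 < u r := fun r hr =>
    hu1.trans_le (hu.antitoneOn hr (right_mem_Icc.2 zero_le_one) hr.2)
  have hvf := hv.radialFlow hp (fun r hr => (H.f0_pos hr).le)
  have hmono := strictMonoOn_of_deriv_pos (convex_Icc 0 1)
    (picone_continuousOn hp hu hvf subset_rfl hpos) (by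
      rw [interior_Icc]
      intro r hr
      have hr' : r ∈ Icc (0:ℝ) 1 := ⟨hr.1.le, hr.2.le⟩
      have hur := hpos r hr'
      have hvr := hv.2.2.2.1 r ⟨hr.1.le, hr.2⟩
      rw [(picone_hasDerivAt hp hu hvf hr hur hvr.le).deriv]
      refine mul_pos (pow_pos hr.1 _) (add_pos_of_pos_of_nonneg ?_
        (youngDefect_nonneg hp (hvf.slope_nonneg r hr')
          (mul_nonneg (by positivity) (hu.slope_nonneg r hr'))))
      have hvp := Real.rpow_pos_of_pos hvr p
      have e1 : v r ^ p = v r * v r ^ (p - 1) := by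
        rw [mul_comm, ← Real.rpow_add_one hvr.ne']; congr 1; ring
      have h1 := hclose (u r) ⟨hur, (hu.antitoneOn (left_mem_Icc.2 zero_le_one) hr' hr.1.le).trans_lt
        hu0⟩ r hr'
      rw [phi_of_nonneg hp hur.le, abs_lt] at h1
      have h2 : f0 a ≤ f0 r := hmin hr'
      have h3 : (1 - lam) * f0 a ≤ (1 - lam) * f0 r :=
        mul_le_mul_of_nonneg_left h2 (by linarith)
      have h4 : 0 < f r (u r) / u r ^ (p - 1) - lam * f0 r := by linarith [h1.1]
      simp only [max_eq_left hur.le]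
      have e2 : f r (u r) * (v r ^ p / u r ^ (p - 1)) - v r * (lam * f0 r * v r ^ (p - 1)) =
          v r ^ p * (f r (u r) / u r ^ (p - 1) - lam * f0 r) := by
        rw [e1]; ring
      rw [e2]
      exact mul_pos hvp h4)
  have h01 := hmono (left_mem_Icc.2 zero_le_one) (right_mem_Icc.2 zero_le_one) one_pos
  have hz : v 1 = 0 := hv.2.2.2.2.2.2
  have f1 := hu.flux_zero hp
  have f2 := hvf.flux_zero hp
  simp only [f1, f2, hz, Real.zero_rpow (by linarith : p ≠ 0), zero_div, mul_zero, zero_mul,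
    sub_zero, lt_irrefl] at h01

lemma HypH.exists_growth {p : ℝ} {N : ℕ} {f f₂ : ℝ → ℝ → ℝ} {f0 finf : ℝ → ℝ}
    (H : HypH p N f f₂ f0 finf) :
    ∃ K ≥ 1, ∀ r ∈ Icc (0:ℝ) 1, ∀ ξ, 0 ≤ ξ → f r ξ ≤ K * ξ ^ (p - 1) := by
  obtain ⟨a, ha, hmax⟩ := isCompact_Icc.exists_isMaxOn (nonempty_Icc.2 zero_le_one) H.hf0_cont
  refine ⟨max 1 (f0 a), le_max_left _ _, fun r hr ξ hξ => (H.le_mul_rpow hr hξ).trans ?_⟩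
  exact mul_le_mul_of_nonneg_right ((show f0 r ≤ f0 a from hmax hr).trans (le_max_right _ _))
    (Real.rpow_nonneg hξ _)

lemma exists_large_shooting_of_zero {p : ℝ} {N : ℕ} {f f₂ : ℝ → ℝ → ℝ} {f0 finf : ℝ → ℝ}
    (H : HypH p N f f₂ f0 finf) (hzero : ∀ r ∈ Icc (0:ℝ) 1, finf r = 0) :
    ∃ D > 0, ∀ u q : ℝ → ℝ, RadialFlow p N u q (fun r => f r (max (u r) 0)) →
      D ≤ u 0 → 0 ≤ u 1 := by
  have hp := H.hp
  obtain ⟨K, hK, hgrow⟩ := H.exists_growth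
  obtain ⟨M, hM⟩ := H.hH5 1 one_pos
  have hM1 : 1 ≤ max M 1 := le_max_right _ _
  refine ⟨K * max M 1, by positivity, fun u q hu hD => ?_⟩
  have hKM : 0 < K * max M 1 := by positivity
  have hu0 : 0 ≤ u 0 := hKM.le.trans hD
  have hbound : ∀ r ∈ Ioo (0:ℝ) 1, f r (max (u r) 0) ≤ u 0 ^ (p - 1) := by
    intro r hr
    have hr' : r ∈ Icc (0:ℝ) 1 := ⟨hr.1.le, hr.2.le⟩
    have hle : max (u r) 0 ≤ u 0 :=
      max_le (hu.antitoneOn (left_mem_Icc.2 zero_le_one) hr' hr.1.le) hu0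
    rcases le_total (max M 1) (max (u r) 0) with hcase | hcase
    · have hpos : 0 < max (u r) 0 := one_pos.trans_le (hM1.trans hcase)
      have h1 := hM _ ((le_max_left M 1).trans hcase) r hr'
      rw [phi_of_nonneg hp hpos.le, hzero r hr', sub_zero, abs_lt,
        div_lt_iff₀ (Real.rpow_pos_of_pos hpos _)] at h1
      have h2 := Real.rpow_le_rpow hpos.le hle (by linarith : 0 ≤ p - 1)
      linarith [h1.2]
    · have h1 := hgrow r hr' _ (le_max_right (u r) 0)
      have h2 := Real.rpow_le_rpow (le_max_right (u r) 0) hcase (by linarith : 0 ≤ p - 1)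
      have h3 := Real.rpow_le_rpow hKM.le hD (by linarith : 0 ≤ p - 1)
      rw [Real.mul_rpow (by linarith) (by linarith)] at h3
      have h4 : K ≤ K ^ (p - 1) := by
        simpa using Real.rpow_le_rpow_of_exponent_le hK (by linarith : 1 ≤ p - 1)
      have h5 : 0 ≤ max M 1 ^ (p - 1) := Real.rpow_nonneg (by linarith) _
      calc _ ≤ K * max (u r) 0 ^ (p - 1) := h1
        _ ≤ K * max M 1 ^ (p - 1) := mul_le_mul_of_nonneg_left h2 (by linarith)
        _ ≤ K ^ (p - 1) * max M 1 ^ (p - 1) := mul_le_mul_of_nonneg_right h4 h5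
        _ ≤ _ := h3
  have := hu.sub_mul_le hp H.hN hu0 hbound (right_mem_Icc.2 zero_le_one)
  linarith

lemma exists_large_shooting_of_eigenpair {p : ℝ} {N : ℕ} {f f₂ : ℝ → ℝ → ℝ} {f0 finf : ℝ → ℝ}
    (H : HypH p N f f₂ f0 finf) (hfinf : ∀ r ∈ Icc (0:ℝ) 1, 0 < finf r) {lam : ℝ}
    (hlam : ∃ v, IsPrincipalEigenpair p N finf lam v) (hlt : 1 < lam) :
    ∃ D > 0, ∀ u q : ℝ → ℝ, RadialFlow p N u q (fun r => f r (max (u r) 0)) →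
      D ≤ u 0 → 0 ≤ u 1 := by
  obtain ⟨v, hv⟩ := hlam
  have hp := H.hp
  have hN := H.hN
  have hN1 : (1 : ℝ) ≤ N := by exact_mod_cast hN
  have hvf := hv.radialFlow hp (fun r hr => (hfinf r hr).le)
  obtain ⟨a, ha, hmin⟩ := isCompact_Icc.exists_isMinOn (nonempty_Icc.2 zero_le_one) H.hfinf_cont
  obtain ⟨K, hK, hgrow⟩ := H.exists_growth
  obtain ⟨κ, hκdef⟩ : ∃ κ, κ = (lam - 1) * finf a / 2 := ⟨_, rfl⟩
  have hκ : 0 < κ := by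
    rw [hκdef]; exact half_pos (mul_pos (by linarith) (hfinf a ha))
  obtain ⟨M', hM'⟩ := H.hH5 κ hκ
  obtain ⟨M, hMdef⟩ : ∃ M, M = max M' 1 := ⟨_, rfl⟩
  have hM1 : 1 ≤ M := hMdef ▸ le_max_right _ _
  have hMM' : M' ≤ M := hMdef ▸ le_max_left _ _
  obtain ⟨B, hBdef⟩ : ∃ B, B = K * M ^ (p - 1) * M := ⟨_, rfl⟩
  have hB : 0 < B := by rw [hBdef]; positivity
  obtain ⟨δ, hδdef⟩ : ∃ δ, δ = 1 / (2 * K) := ⟨_, rfl⟩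
  have hδ : 0 < δ := by rw [hδdef]; positivity
  have hδ1 : δ ≤ 1 := by
    rw [hδdef, div_le_one (by positivity)]; linarith
  have hKδ : K * δ = 1 / 2 := by rw [hδdef]; field_simp
  have hκδ : 0 < κ * δ ^ N := by positivity
  refine ⟨2 * M + 2 * (B / (κ * δ ^ N)), by positivity, fun u q hu hD => ?_⟩
  have hBκ : 0 < B / (κ * δ ^ N) := by positivity
  have hu0 : 2 ≤ u 0 := by linarith
  have hu0M : M ≤ u 0 / 2 := by linarith
  have hu0B : B / (κ * δ ^ N) < u 0 / 2 := by linarith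
  by_contra! hu1
  have hmem0 : (0 : ℝ) ∈ Icc (0:ℝ) 1 := left_mem_Icc.2 zero_le_one
  obtain ⟨R, hR, hRu⟩ := intermediate_value_Icc' zero_le_one hu.cont
    (show (0:ℝ) ∈ Icc (u 1) (u 0) from ⟨hu1.le, by linarith⟩)
  have hR1 : R < 1 := lt_of_le_of_ne hR.2 (by rintro rfl; linarith)
  have hbound : ∀ r ∈ Ioo (0:ℝ) 1, f r (max (u r) 0) ≤ (K * u 0) ^ (p - 1) := by
    intro r hr
    have hr' : r ∈ Icc (0:ℝ) 1 := ⟨hr.1.le, hr.2.le⟩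
    have hle : max (u r) 0 ≤ u 0 :=
      max_le (hu.antitoneOn hmem0 hr' hr.1.le) (by linarith)
    have h1 := hgrow r hr' _ (le_max_right (u r) 0)
    have h2 := Real.rpow_le_rpow (le_max_right (u r) 0) hle (by linarith : 0 ≤ p - 1)
    have h4 : K ≤ K ^ (p - 1) := by
      simpa using Real.rpow_le_rpow_of_exponent_le hK (by linarith : 1 ≤ p - 1)
    rw [Real.mul_rpow (by linarith) (by linarith)]
    calc _ ≤ K * max (u r) 0 ^ (p - 1) := h1
      _ ≤ K * u 0 ^ (p - 1) := mul_le_mul_of_nonneg_left h2 (by linarith)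
      _ ≤ _ := mul_le_mul_of_nonneg_right h4 (Real.rpow_nonneg (by linarith) _)
  have hhalf : ∀ r ∈ Icc 0 δ, u 0 / 2 ≤ u r := by
    intro r hr
    have h1 := hu.sub_mul_le hp hN (B := K * u 0) (by positivity) hbound
      (r := r) ⟨hr.1, hr.2.trans hδ1⟩
    have h2 : K * u 0 * r ≤ u 0 / 2 := by
      calc K * u 0 * r ≤ K * u 0 * δ := mul_le_mul_of_nonneg_left hr.2 (by positivity)
        _ = u 0 * (K * δ) := by ring
        _ = u 0 / 2 := by rw [hKδ]; ring
    linarith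
  have hδR : δ < R := by
    by_contra! hle
    have := hhalf R ⟨hR.1, hle⟩
    linarith
  have hsub : Icc 0 R ⊆ Icc (0:ℝ) 1 := Icc_subset_Icc_right hR1.le
  have hvpos : ∀ r ∈ Icc 0 R, 0 < v r := fun r hr => hv.2.2.2.1 r ⟨hr.1, hr.2.trans_lt hR1⟩
  have hunn : ∀ r ∈ Icc 0 R, 0 ≤ u r := fun r hr => hRu ▸ hu.antitoneOn (hsub hr) hR hr.2
  have hcont := picone_continuousOn hp hvf hu hsub hvpos
  have hderiv : ∀ r ∈ Ioo 0 R, _ := fun r hr =>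
    picone_hasDerivAt hp hvf hu (r := r) ⟨hr.1, hr.2.trans hR1⟩ (hvpos r ⟨hr.1.le, hr.2.le⟩)
      (hunn r ⟨hr.1.le, hr.2.le⟩)
  have hlower : ∀ r ∈ Ioo 0 R, ∀ c : ℝ, c ≤ lam * finf r * u r ^ p - u r * f r (u r) →
      r ^ (N - 1) * c ≤ r ^ (N - 1) * (lam * finf r * v r ^ (p - 1) *
        (u r ^ p / v r ^ (p - 1)) - u r * f r (max (u r) 0) +
        youngDefect p (q r) (u r / v r * -(deriv01 v r))) := by
    intro r hr c hc
    have hr' := hsub ⟨hr.1.le, hr.2.le⟩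
    have hvr := hvpos r ⟨hr.1.le, hr.2.le⟩
    have hur := hunn r ⟨hr.1.le, hr.2.le⟩
    refine mul_le_mul_of_nonneg_left ?_ (pow_nonneg hr.1.le _)
    have hY := youngDefect_nonneg hp (hu.slope_nonneg r hr')
      (mul_nonneg (div_nonneg hur hvr.le) (hvf.slope_nonneg r hr'))
    have e : lam * finf r * v r ^ (p - 1) * (u r ^ p / v r ^ (p - 1)) = lam * finf r * u r ^ p := by
      have := (Real.rpow_pos_of_pos hvr (p - 1)).ne'
      field_simp
    rw [e, max_eq_left hur]
    linarith
  have key : ∀ x : ℝ, 0 < x → x ^ p = x * x ^ (p - 1) := by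
    intro x hx
    rw [mul_comm, ← Real.rpow_add_one hx.ne']; congr 1; ring
  have hbig : ∀ r ∈ Ioo 0 R, M ≤ u r →
      κ * u r ^ p ≤ lam * finf r * u r ^ p - u r * f r (u r) := by
    intro r hr hMu
    have hr' := hsub ⟨hr.1.le, hr.2.le⟩
    have hur : 0 < u r := by linarith
    have h1 := hM' (u r) (hMM'.trans hMu) r hr'
    rw [phi_of_nonneg hp hur.le, abs_lt] at h1
    have h2 : f r (u r) ≤ (finf r + κ) * u r ^ (p - 1) :=
      (div_le_iff₀ (Real.rpow_pos_of_pos hur _)).1 (by linarith [h1.2])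
    have h3 := mul_le_mul_of_nonneg_left h2 hur.le
    have h4 : (lam - 1) * finf a ≤ (lam - 1) * finf r :=
      mul_le_mul_of_nonneg_left (hmin hr') (by linarith)
    have h5 : 0 ≤ ((lam - 1) * finf r - 2 * κ) * u r ^ p :=
      mul_nonneg (by rw [hκdef]; linarith) (Real.rpow_nonneg hur.le _)
    have h6 : u r * ((finf r + κ) * u r ^ (p - 1)) = (finf r + κ) * u r ^ p := by
      rw [key _ hur]; ring
    linarith
  have hall : ∀ r ∈ Ioo 0 R, -B ≤ lam * finf r * u r ^ p - u r * f r (u r) := by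
    intro r hr
    have hr' := hsub ⟨hr.1.le, hr.2.le⟩
    have hur := hunn r ⟨hr.1.le, hr.2.le⟩
    have hup := Real.rpow_nonneg hur p
    rcases le_total M (u r) with hcase | hcase
    · have := hbig r hr hcase
      have := mul_nonneg hκ.le hup
      linarith
    · have h1 : f r (u r) ≤ K * M ^ (p - 1) := (hgrow r hr' _ hur).trans
        (mul_le_mul_of_nonneg_left (Real.rpow_le_rpow hur hcase (by linarith)) (by linarith))
      have h2 : u r * f r (u r) ≤ M * (K * M ^ (p - 1)) :=
        mul_le_mul hcase h1 (H.nonneg hr' _) (by linarith)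
      have h3 : 0 ≤ lam * finf r * u r ^ p :=
        mul_nonneg (mul_nonneg (by linarith) (hfinf r hr').le) hup
      rw [hBdef]
      linarith
  obtain ⟨A, hAdef⟩ : ∃ A, A = κ * (u 0 / 2) := ⟨_, rfl⟩
  have hA : 0 < A := by rw [hAdef]; exact mul_pos hκ (by linarith)
  have hABδ : B < A * δ ^ N := by
    have := (div_lt_iff₀ hκδ).1 hu0B
    rw [hAdef]
    linarith
  have hfirst : ∀ r ∈ Ioo 0 δ, A ≤ lam * finf r * u r ^ p - u r * f r (u r) := by
    intro r hr
    have hur := hhalf r ⟨hr.1.le, hr.2.le⟩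
    refine le_trans ?_ (hbig r ⟨hr.1, hr.2.trans hδR⟩ (by linarith))
    rw [hAdef]
    refine mul_le_mul_of_nonneg_left (hur.trans ?_) hκ.le
    simpa using Real.rpow_le_rpow_of_exponent_le (by linarith : 1 ≤ u r) (by linarith : 1 ≤ p)
  have hcompare : ∀ a b c : ℝ, 0 ≤ a → a ≤ b → b ≤ R →
      (∀ r ∈ Ioo a b, c ≤ lam * finf r * u r ^ p - u r * f r (u r)) →
      MonotoneOn (fun s => (s ^ (N - 1) * (-(deriv01 v s)) ^ (p - 1)) *
        (u s ^ p / v s ^ (p - 1)) - u s * (s ^ (N - 1) * q s ^ (p - 1)) - c / N * s ^ N)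
        (Icc a b) := by
    intro a b c ha hab hb hc
    have hsub' : Ioo a b ⊆ Ioo 0 R := Ioo_subset_Ioo ha hb
    have hd : ∀ r ∈ Ioo a b, HasDerivAt (fun s => (s ^ (N - 1) * (-(deriv01 v s)) ^ (p - 1)) *
        (u s ^ p / v s ^ (p - 1)) - u s * (s ^ (N - 1) * q s ^ (p - 1)) - c / N * s ^ N) _ r :=
      fun r hr => (hderiv r (hsub' hr)).sub ((hasDerivAt_pow N r).const_mul (c / N))
    refine monotoneOn_of_deriv_nonneg (convex_Icc a b)
      ((hcont.mono (Icc_subset_Icc ha hb)).sub (by fun_prop)) ?_ ?_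
    · rw [interior_Icc]
      exact fun r hr => (hd r hr).differentiableAt.differentiableWithinAt
    · rw [interior_Icc]
      intro r hr
      rw [(hd r hr).deriv]
      have h1 := hlower r (hsub' hr) c (hc r hr)
      have h2 : c / N * (N * r ^ (N - 1)) = r ^ (N - 1) * c := by
        have : (N : ℝ) ≠ 0 := by linarith
        field_simp
      rw [h2]
      linarith
  have m1 := hcompare 0 δ A le_rfl hδ.le hδR.le hfirst
    (left_mem_Icc.2 hδ.le) (right_mem_Icc.2 hδ.le) hδ.le
  have m2 := hcompare δ R (-B) hδ.le hδR.le le_rfl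
    (fun r hr => hall r ⟨hδ.trans hr.1, hr.2⟩)
    (left_mem_Icc.2 hδR.le) (right_mem_Icc.2 hδR.le) hδR.le
  have f1 := hu.flux_zero hp
  have f2 := hvf.flux_zero hp
  simp only [f1, f2, hRu, Real.zero_rpow (by linarith : p ≠ 0), zero_div, mul_zero, zero_mul,
    sub_zero, zero_pow (by omega : N ≠ 0)] at m1 m2
  have hRN : R ^ N ≤ 1 := pow_le_one₀ hR.1 hR1.le
  have hδN : 0 ≤ δ ^ N := by positivity
  have hfin : A / N * δ ^ N ≤ B / N * R ^ N := by
    have : 0 ≤ B / N * δ ^ N := by positivity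
    have e : -B / N * R ^ N = -(B / N * R ^ N) := by ring
    have e' : -B / N * δ ^ N = -(B / N * δ ^ N) := by ring
    rw [e, e'] at m2
    linarith
  have hNpos : (0 : ℝ) < N := by linarith
  have h1 : A * δ ^ N ≤ B * R ^ N := by
    have := mul_le_mul_of_nonneg_left hfin hNpos.le
    have e1 : (N : ℝ) * (A / N * δ ^ N) = A * δ ^ N := by field_simp
    have e2 : (N : ℝ) * (B / N * R ^ N) = B * R ^ N := by field_simp
    linarith
  nlinarith

lemma RadialFlow.exists_linear_upper_bound {p : ℝ} {N : ℕ} {u q g : ℝ → ℝ}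
    (h : RadialFlow p N u q g) (h1 : u 1 = 0) :
    ∃ B ≥ 0, ∀ r ∈ Icc (0:ℝ) 1, u r ≤ B * (1 - r) := by
  obtain ⟨a, ha, hmax⟩ := isCompact_Icc.exists_isMaxOn (nonempty_Icc.2 zero_le_one) h.slope_cont
  refine ⟨q a, h.slope_nonneg a ha, fun r hr => ?_⟩
  have hmono : MonotoneOn (fun s => u s + q a * s) (Icc 0 1) := by
    refine monotoneOn_of_deriv_nonneg (convex_Icc 0 1) (h.cont.add (by fun_prop)) ?_ ?_
    · rw [interior_Icc]
      exact fun s hs => ((h.hasDeriv s hs).differentiableAt.add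
        (by fun_prop)).differentiableWithinAt
    · rw [interior_Icc]
      intro s hs
      have hd : HasDerivAt (fun s => u s + q a * s) (-(q s) + q a * 1) s :=
        (h.hasDeriv s hs).add ((hasDerivAt_id s).const_mul _)
      rw [hd.deriv]
      have : q s ≤ q a := hmax ⟨hs.1.le, hs.2.le⟩
      linarith
  have := hmono hr (right_mem_Icc.2 zero_le_one) hr.2
  simp only [h1] at this
  linarith

lemma exists_picone_le {p : ℝ} {N : ℕ} (hp : 2 < p) {u v qu qv gu gv : ℝ → ℝ}
    (hu : RadialFlow p N u qu gu) (hv : RadialFlow p N v qv gv)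
    (hgu : ∀ r ∈ Ioo (0:ℝ) 1, 0 ≤ gu r) (hupos : ∀ r ∈ Ico (0:ℝ) 1, 0 < u r) (hu1 : u 1 = 0)
    (hvpos : ∀ r ∈ Ico (0:ℝ) 1, 0 < v r) (hv1 : v 1 = 0) :
    ∃ C, ∃ a ∈ Ico (0:ℝ) 1, ∀ r ∈ Ico a 1,
      (r ^ (N - 1) * qu r ^ (p - 1)) * (v r ^ p / u r ^ (p - 1)) -
        v r * (r ^ (N - 1) * qv r ^ (p - 1)) ≤ C * v r := by
  obtain ⟨k, hk, a, ha, hlow⟩ := hu.exists_linear_lower_bound hp hgu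
    (hupos 0 ⟨le_rfl, one_pos⟩) hu1
  obtain ⟨B, hB, hup⟩ := hv.exists_linear_upper_bound hv1
  refine ⟨(1:ℝ) ^ (N - 1) * qu 1 ^ (p - 1) * (B / k) ^ (p - 1), a, ha, fun r hr => ?_⟩
  have hr' : r ∈ Icc (0:ℝ) 1 := ⟨ha.1.trans hr.1, hr.2.le⟩
  have hur := hupos r ⟨hr'.1, hr.2⟩
  have hvr := hvpos r ⟨hr'.1, hr.2⟩
  have h1 : v r / u r ≤ B / k := by
    rw [div_le_div_iff₀ hur hk]
    calc v r * k ≤ B * (1 - r) * k := mul_le_mul_of_nonneg_right (hup r hr') hk.le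
      _ = B * (k * (1 - r)) := by ring
      _ ≤ B * u r := mul_le_mul_of_nonneg_left (hlow r ⟨hr.1, hr.2.le⟩) hB
  have h2 : (v r / u r) ^ (p - 1) ≤ (B / k) ^ (p - 1) :=
    Real.rpow_le_rpow (by positivity) h1 (by linarith)
  have h3 : r ^ (N - 1) * qu r ^ (p - 1) ≤ (1:ℝ) ^ (N - 1) * qu 1 ^ (p - 1) :=
    hu.flux_monotoneOn hp hgu hr' (right_mem_Icc.2 zero_le_one) hr.2.le
  have h4 : 0 ≤ r ^ (N - 1) * qu r ^ (p - 1) :=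
    mul_nonneg (pow_nonneg hr'.1 _) (Real.rpow_nonneg (hu.slope_nonneg r hr') _)
  have h5 : 0 ≤ r ^ (N - 1) * qv r ^ (p - 1) :=
    mul_nonneg (pow_nonneg hr'.1 _) (Real.rpow_nonneg (hv.slope_nonneg r hr') _)
  have e : v r ^ p / u r ^ (p - 1) = v r * (v r / u r) ^ (p - 1) := by
    rw [Real.div_rpow hvr.le hur.le]
    have : v r ^ p = v r * v r ^ (p - 1) := by
      rw [mul_comm, ← Real.rpow_add_one hvr.ne']; congr 1; ring
    rw [this]; ring
  have h6 := mul_le_mul h3 h2 (Real.rpow_nonneg (by positivity) _) (h4.trans h3)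
  have h7 := mul_le_mul_of_nonneg_right h6 hvr.le
  have h8 := mul_nonneg hvr.le h5
  rw [e]
  linarith

lemma HypH.positive_unique {p : ℝ} {N : ℕ} {f f₂ : ℝ → ℝ → ℝ} {f0 finf : ℝ → ℝ}
    (H : HypH p N f f₂ f0 finf) {u v qu qv : ℝ → ℝ}
    (hu : RadialFlow p N u qu (fun r => f r (u r)))
    (hv : RadialFlow p N v qv (fun r => f r (v r)))
    (hupos : ∀ r ∈ Ico (0:ℝ) 1, 0 < u r) (hu1 : u 1 = 0)
    (hvpos : ∀ r ∈ Ico (0:ℝ) 1, 0 < v r) (hv1 : v 1 = 0) : EqOn u v (Icc 0 1) := by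
  have hp := H.hp
  have hgu : ∀ r ∈ Ioo (0:ℝ) 1, 0 ≤ f r (u r) := fun r hr => H.nonneg ⟨hr.1.le, hr.2.le⟩ _
  have hgv : ∀ r ∈ Ioo (0:ℝ) 1, 0 ≤ f r (v r) := fun r hr => H.nonneg ⟨hr.1.le, hr.2.le⟩ _
  obtain ⟨C₁, a₁, ha₁, hP⟩ := exists_picone_le hp hu hv hgu hupos hu1 hvpos hv1
  obtain ⟨C₂, a₂, ha₂, hQ⟩ := exists_picone_le hp hv hu hgv hvpos hv1 hupos hu1
  obtain ⟨S, hS⟩ : ∃ S : ℝ → ℝ, S = fun s =>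
      ((s ^ (N - 1) * qu s ^ (p - 1)) * (v s ^ p / u s ^ (p - 1)) -
        v s * (s ^ (N - 1) * qv s ^ (p - 1))) +
      ((s ^ (N - 1) * qv s ^ (p - 1)) * (u s ^ p / v s ^ (p - 1)) -
        u s * (s ^ (N - 1) * qu s ^ (p - 1))) := ⟨_, rfl⟩
  have hScont : ContinuousOn S (Ico 0 1) := by
    rw [hS]
    exact (picone_continuousOn hp hu hv Ico_subset_Icc_self hupos).add
      (picone_continuousOn hp hv hu Ico_subset_Icc_self hvpos)
  have hkey : ∀ x : ℝ, 0 < x → x ^ p = x * x ^ (p - 1) := by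
    intro x hx
    rw [mul_comm, ← Real.rpow_add_one hx.ne']; congr 1; ring
  have hSd : ∀ r ∈ Ioo (0:ℝ) 1, HasDerivAt S (r ^ (N - 1) *
      ((v r ^ p - u r ^ p) * (f r (u r) / u r ^ (p - 1) - f r (v r) / v r ^ (p - 1)) +
        youngDefect p (qv r) (v r / u r * qu r) + youngDefect p (qu r) (u r / v r * qv r))) r := by
    intro r hr
    have hur := hupos r ⟨hr.1.le, hr.2⟩
    have hvr := hvpos r ⟨hr.1.le, hr.2⟩
    rw [hS]
    refine ((picone_hasDerivAt hp hu hv hr hur hvr.le).add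
      (picone_hasDerivAt hp hv hu hr hvr hur.le)).congr_deriv ?_
    rw [hkey _ hur, hkey _ hvr]
    have h1 := (Real.rpow_pos_of_pos hur (p - 1)).ne'
    have h2 := (Real.rpow_pos_of_pos hvr (p - 1)).ne'
    field_simp
    ring
  have hterm1 : ∀ r ∈ Ioo (0:ℝ) 1, 0 ≤ (v r ^ p - u r ^ p) *
      (f r (u r) / u r ^ (p - 1) - f r (v r) / v r ^ (p - 1)) := by
    intro r hr
    have hur := hupos r ⟨hr.1.le, hr.2⟩
    have hvr := hvpos r ⟨hr.1.le, hr.2⟩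
    have hanti := H.ratio_antitoneOn (r := r) ⟨hr.1.le, hr.2.le⟩
    rcases le_total (u r) (v r) with h | h
    · exact mul_nonneg (sub_nonneg.2 (Real.rpow_le_rpow hur.le h (by linarith)))
        (sub_nonneg.2 (hanti (mem_Ioi.2 hur) (mem_Ioi.2 hvr) h))
    · exact mul_nonneg_of_nonpos_of_nonpos
        (sub_nonpos.2 (Real.rpow_le_rpow hvr.le h (by linarith)))
        (sub_nonpos.2 (hanti (mem_Ioi.2 hvr) (mem_Ioi.2 hur) h))
  have hterm2 : ∀ r ∈ Ioo (0:ℝ) 1, 0 ≤ youngDefect p (qv r) (v r / u r * qu r) := fun r hr =>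
    youngDefect_nonneg hp (hv.slope_nonneg r ⟨hr.1.le, hr.2.le⟩)
      (mul_nonneg (div_nonneg (hvpos r ⟨hr.1.le, hr.2⟩).le (hupos r ⟨hr.1.le, hr.2⟩).le)
        (hu.slope_nonneg r ⟨hr.1.le, hr.2.le⟩))
  have hterm3 : ∀ r ∈ Ioo (0:ℝ) 1, 0 ≤ youngDefect p (qu r) (u r / v r * qv r) := fun r hr =>
    youngDefect_nonneg hp (hu.slope_nonneg r ⟨hr.1.le, hr.2.le⟩)
      (mul_nonneg (div_nonneg (hupos r ⟨hr.1.le, hr.2⟩).le (hvpos r ⟨hr.1.le, hr.2⟩).le)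
        (hv.slope_nonneg r ⟨hr.1.le, hr.2.le⟩))
  have hmono : MonotoneOn S (Ico 0 1) := by
    refine monotoneOn_of_deriv_nonneg (convex_Ico 0 1) hScont ?_ ?_
    · rw [interior_Ico]
      exact fun r hr => (hSd r hr).differentiableAt.differentiableWithinAt
    · rw [interior_Ico]
      intro r hr
      rw [(hSd r hr).deriv]
      have := hterm1 r hr
      have := hterm2 r hr
      have := hterm3 r hr
      exact mul_nonneg (pow_nonneg hr.1.le _) (by linarith)
  have hS0 : S 0 = 0 := by
    rw [hS]
    simp only [hu.flux_zero hp, hv.flux_zero hp, zero_mul, mul_zero, sub_zero, add_zero]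
  have hSzero : ∀ r ∈ Ico (0:ℝ) 1, S r = 0 := by
    intro r hr
    refine le_antisymm ?_ (hS0 ▸ hmono ⟨le_rfl, one_pos⟩ hr hr.1)
    have hlim : Tendsto (fun s => C₁ * v s + C₂ * u s) (𝓝[<] 1) (𝓝 0) := by
      have hle : 𝓝[<] (1:ℝ) ≤ 𝓝[Icc 0 1] 1 := by
        rw [← nhdsWithin_Ioo_eq_nhdsLT (zero_lt_one' ℝ)]
        exact nhdsWithin_mono _ Ioo_subset_Icc_self
      have h1 := (hv.cont 1 (right_mem_Icc.2 zero_le_one)).tendsto.mono_left hle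
      have h2 := (hu.cont 1 (right_mem_Icc.2 zero_le_one)).tendsto.mono_left hle
      have := (h1.const_mul C₁).add (h2.const_mul C₂)
      rwa [hu1, hv1, mul_zero, mul_zero, add_zero] at this
    refine ge_of_tendsto hlim ?_
    have hlt : max r (max a₁ a₂) < 1 := max_lt hr.2 (max_lt ha₁.2 ha₂.2)
    filter_upwards [Ioo_mem_nhdsLT hlt] with s hs
    have h1 : r < s := (le_max_left _ _).trans_lt hs.1
    have h2 : a₁ < s := ((le_max_left _ _).trans (le_max_right _ _)).trans_lt hs.1
    have h3 : a₂ < s := ((le_max_right _ _).trans (le_max_right _ _)).trans_lt hs.1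
    have h4 := hmono hr ⟨hr.1.trans h1.le, hs.2⟩ h1.le
    have h5 := hP s ⟨h2.le, hs.2⟩
    have h6 := hQ s ⟨h3.le, hs.2⟩
    refine h4.trans ?_
    rw [hS]
    exact add_le_add h5 h6
  have hsum : ∀ r ∈ Ioo (0:ℝ) 1,
      (v r ^ p - u r ^ p) * (f r (u r) / u r ^ (p - 1) - f r (v r) / v r ^ (p - 1)) +
        youngDefect p (qv r) (v r / u r * qu r) +
          youngDefect p (qu r) (u r / v r * qv r) = 0 := by
    intro r hr
    have hd : HasDerivAt S 0 r := (hasDerivAt_const r (0:ℝ)).congr_of_eventuallyEq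
      (by filter_upwards [Ioo_mem_nhds hr.1 hr.2] with x hx using hSzero x ⟨hx.1.le, hx.2⟩)
    exact (mul_eq_zero.1 ((hSd r hr).unique hd)).resolve_left (pow_pos hr.1 _).ne'
  have hlog : ∀ r ∈ Ioo (0:ℝ) 1, qv r = v r / u r * qu r := by
    intro r hr
    have hr' : r ∈ Icc (0:ℝ) 1 := ⟨hr.1.le, hr.2.le⟩
    refine eq_of_youngDefect_nonpos hp (hv.slope_nonneg r hr')
      (mul_nonneg (div_nonneg (hvpos r ⟨hr.1.le, hr.2⟩).le (hupos r ⟨hr.1.le, hr.2⟩).le)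
        (hu.slope_nonneg r hr')) ?_
    linarith [hsum r hr, hterm1 r hr, hterm3 r hr]
  obtain ⟨δ, hδ, ε, hε, hstrict⟩ := H.exists_ratio_strictAntiOn
  obtain ⟨r₀, hr₀, hr₀eq⟩ : ∃ r₀ ∈ Ioo (0:ℝ) 1, u r₀ = v r₀ := by
    have hev : ∀ w qw gw : ℝ → ℝ, RadialFlow p N w qw gw → w 1 = 0 →
        ∀ᶠ s in 𝓝[<] (1:ℝ), w s < ε := by
      intro w qw gw hw hw1
      have hle : 𝓝[<] (1:ℝ) ≤ 𝓝[Icc 0 1] 1 := by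
        rw [← nhdsWithin_Ioo_eq_nhdsLT (zero_lt_one' ℝ)]
        exact nhdsWithin_mono _ Ioo_subset_Icc_self
      exact ((hw.cont 1 (right_mem_Icc.2 zero_le_one)).tendsto.mono_left hle).eventually
        (gt_mem_nhds (by rw [hw1]; exact hε))
    have hlt : max 0 (1 - δ) < 1 := max_lt one_pos (by linarith)
    obtain ⟨s, ⟨hsu, hsv⟩, hs⟩ := (((hev u _ _ hu hu1).and (hev v _ _ hv hv1)).and
      (Ioo_mem_nhdsLT hlt)).exists
    have hs' : s ∈ Ioo (0:ℝ) 1 := ⟨(le_max_left _ _).trans_lt hs.1, hs.2⟩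
    have hus := hupos s ⟨hs'.1.le, hs'.2⟩
    have hvs := hvpos s ⟨hs'.1.le, hs'.2⟩
    have hst := hstrict s ⟨hs'.1.le, hs'.2.le⟩ ((le_max_right _ _).trans_lt hs.1)
    refine ⟨s, hs', ?_⟩
    have h0 : (v s ^ p - u s ^ p) *
        (f s (u s) / u s ^ (p - 1) - f s (v s) / v s ^ (p - 1)) ≤ 0 := by
      linarith [hsum s hs', hterm2 s hs', hterm3 s hs']
    rcases lt_trichotomy (u s) (v s) with h | h | h
    · have h1 := hst ⟨hus, hsu⟩ ⟨hvs, hsv⟩ h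
      have := mul_pos (sub_pos.2 (Real.rpow_lt_rpow hus.le h (by linarith : 0 < p)))
        (sub_pos.2 h1)
      linarith
    · exact h
    · have h1 := hst ⟨hvs, hsv⟩ ⟨hus, hsu⟩ h
      have := mul_pos_of_neg_of_neg (sub_neg.2 (Real.rpow_lt_rpow hvs.le h (by linarith : 0 < p)))
        (sub_neg.2 h1)
      linarith
  have hquot : ∀ r ∈ Ioo (0:ℝ) 1, HasDerivAt (fun s => v s / u s) 0 r := by
    intro r hr
    have hur := (hupos r ⟨hr.1.le, hr.2⟩).ne'
    refine ((hv.hasDeriv r hr).div (hu.hasDeriv r hr) hur).congr_deriv ?_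
    rw [hlog r hr]
    field_simp
    ring
  have hopen : EqOn u v (Ioo 0 1) := by
    intro r hr
    have hconst := (convex_Ioo (0:ℝ) 1).is_const_of_fderivWithin_eq_zero (𝕜 := ℝ)
      (f := fun s => v s / u s)
      (fun s hs => (hquot s hs).differentiableAt.differentiableWithinAt)
      (fun s hs => by
        have := (hquot s hs).hasFDerivAt.hasFDerivWithinAt (s := Ioo 0 1)
        rw [this.fderivWithin (isOpen_Ioo.uniqueDiffWithinAt hs)]
        ext; simp) hr hr₀
    have h1 := (hupos r ⟨hr.1.le, hr.2⟩).ne'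
    have h2 := (hupos r₀ ⟨hr₀.1.le, hr₀.2⟩).ne'
    simp only [← hr₀eq, div_self h2] at hconst
    exact ((div_eq_one_iff_eq h1).1 hconst).symm
  exact hopen.of_subset_closure hu.cont hv.cont Ioo_subset_Icc_self
    (by rw [closure_Ioo (zero_ne_one' ℝ)])

/-- The radial mean `s^(-N) ∫_0^s t^(N-1) h(t) dt`, in scale-invariant form. -/
def radialMean (N : ℕ) (h : ℝ → ℝ) (s : ℝ) : ℝ := ∫ τ in (0:ℝ)..1, τ ^ (N - 1) * h (τ * s)

/-- The slope `φ_p^{-1}(s · radialMean)` of the radial profile with source `h`. -/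
def radialSlope (p : ℝ) (N : ℕ) (h : ℝ → ℝ) (s : ℝ) : ℝ := (s * radialMean N h s) ^ (1 / (p - 1))

/-- The radial profile with source `h` and central value `d`. -/
def radialProfile (p : ℝ) (N : ℕ) (h : ℝ → ℝ) (d r : ℝ) : ℝ :=
  d - ∫ s in (0:ℝ)..r, radialSlope p N h s

section Profile

variable {p : ℝ} {N : ℕ} {h : ℝ → ℝ}

lemma continuous_radialMean (hh : Continuous h) : Continuous (radialMean N h) := by
  unfold radialMean
  exact intervalIntegral.continuous_parametric_intervalIntegral_of_continuous'
    (f := fun s τ => τ ^ (N - 1) * h (τ * s)) (by simp only [Function.uncurry_def]; fun_prop) 0 1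

lemma continuous_radialSlope (hp : 2 < p) (hh : Continuous h) : Continuous (radialSlope p N h) := by
  unfold radialSlope
  exact (Real.continuous_rpow_const (by
    have : 0 < p - 1 := by linarith
    positivity)).comp (continuous_id.mul (continuous_radialMean hh))

lemma pow_mul_radialMean (hN : 1 ≤ N) (s : ℝ) :
    s ^ N * radialMean N h s = ∫ t in (0:ℝ)..s, t ^ (N - 1) * h t := by
  have h1 := intervalIntegral.mul_integral_comp_mul_right (a := 0) (b := 1)
    (f := fun t => t ^ (N - 1) * h t) s
  rw [zero_mul, one_mul] at h1
  rw [← h1, radialMean, ← intervalIntegral.integral_const_mul,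
    ← intervalIntegral.integral_const_mul]
  congr 1
  ext τ
  have : s ^ N = s * s ^ (N - 1) := by rw [← pow_succ']; congr 1; omega
  rw [this, mul_pow]
  ring

lemma radialMean_nonneg (hh0 : ∀ t, 0 ≤ h t) (s : ℝ) : 0 ≤ radialMean N h s :=
  intervalIntegral.integral_nonneg zero_le_one fun _ hτ => mul_nonneg (pow_nonneg hτ.1 _) (hh0 _)

lemma hasDerivAt_radialProfile (hp : 2 < p) (hh : Continuous h) (d r : ℝ) :
    HasDerivAt (radialProfile p N h d) (-(radialSlope p N h r)) r :=
  ((continuous_radialSlope hp hh).integral_hasStrictDerivAt 0 r).hasDerivAt.const_sub d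

lemma radialSlope_rpow (hp : 2 < p) (hh0 : ∀ t, 0 ≤ h t) {s : ℝ} (hs : 0 ≤ s) :
    radialSlope p N h s ^ (p - 1) = s * radialMean N h s := by
  rw [radialSlope, ← Real.rpow_mul (mul_nonneg hs (radialMean_nonneg hh0 s)), one_div,
    inv_mul_cancel₀ (by linarith), Real.rpow_one]

lemma radialSlope_nonneg (hh0 : ∀ t, 0 ≤ h t) {s : ℝ} (hs : 0 ≤ s) :
    0 ≤ radialSlope p N h s :=
  Real.rpow_nonneg (mul_nonneg hs (radialMean_nonneg hh0 s)) _

lemma hasDerivAt_integral_flux (hh : Continuous h) (r : ℝ) :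
    HasDerivAt (fun s => ∫ t in (0:ℝ)..s, t ^ (N - 1) * h t) (r ^ (N - 1) * h r) r :=
  (Continuous.integral_hasStrictDerivAt (f := fun t => t ^ (N - 1) * h t)
    (by fun_prop) 0 r).hasDerivAt

lemma radialFlow_radialProfile (hp : 2 < p) (hN : 1 ≤ N) (hh : Continuous h)
    (hh0 : ∀ t, 0 ≤ h t) (d : ℝ) :
    RadialFlow p N (radialProfile p N h d) (radialSlope p N h) h where
  cont := fun r _ => (hasDerivAt_radialProfile hp hh d r).continuousAt.continuousWithinAt
  hasDeriv := fun r _ => hasDerivAt_radialProfile hp hh d r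
  slope_cont := (continuous_radialSlope hp hh).continuousOn
  slope_nonneg := fun _ hr => radialSlope_nonneg hh0 hr.1
  slope_zero := by
    rw [radialSlope, zero_mul, Real.zero_rpow]
    have : 0 < p - 1 := by linarith
    positivity
  hasDeriv_flux := by
    intro r hr
    refine (hasDerivAt_integral_flux hh r).congr_of_eventuallyEq ?_
    filter_upwards [lt_mem_nhds hr.1] with s hs
    rw [radialSlope_rpow hp hh0 hs.le, ← pow_mul_radialMean hN, ← mul_assoc, ← pow_succ]
    congr 2; omega

lemma hasDerivAt_mul_radialMean (hN : 1 ≤ N) (hh : Continuous h) {r : ℝ} (hr : 0 ≤ r) :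
    HasDerivAt (fun s => s * radialMean N h s) (h r - (N - 1) * radialMean N h r) r := by
  have hN1 : (1 : ℝ) ≤ N := by exact_mod_cast hN
  have hN0 : (N : ℝ) ≠ 0 := by linarith
  rcases hr.eq_or_lt with rfl | hr
  · have h0 : radialMean N h 0 = h 0 / N := by
      simp only [radialMean, mul_zero, intervalIntegral.integral_mul_const, integral_pow]
      rw [Nat.cast_sub hN, Nat.cast_one, sub_add_cancel, one_pow, zero_pow (by omega)]
      ring
    have e : h 0 - (N - 1) * radialMean N h 0 = radialMean N h 0 := by
      rw [h0]; field_simp; ring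
    rw [e, hasDerivAt_iff_tendsto_slope]
    refine (((continuous_radialMean (N := N) hh).tendsto 0).mono_left nhdsWithin_le_nhds).congr' ?_
    filter_upwards [self_mem_nhdsWithin] with s hs
    have hs' : s ≠ 0 := hs
    rw [slope_def_field]
    field_simp
    ring
  · have hA := (hasDerivAt_integral_flux (N := N) hh r).div (hasDerivAt_pow N r)
      (pow_pos hr N).ne'
    have hev : radialMean N h =ᶠ[𝓝 r] (fun s => ∫ t in (0:ℝ)..s, t ^ (N - 1) * h t) /
        (fun s => s ^ N) := by
      filter_upwards [lt_mem_nhds hr] with s hs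
      rw [Pi.div_apply, ← pow_mul_radialMean hN, mul_div_cancel_left₀ _ (pow_pos hs N).ne']
    refine ((hasDerivAt_id r).mul (hA.congr_of_eventuallyEq hev)).congr_deriv ?_
    have hpow : r ^ N = r ^ (N - 1) * r := by rw [← pow_succ]; congr 1; omega
    have hr1 := (pow_pos hr (N - 1)).ne'
    rw [← pow_mul_radialMean hN, hpow]
    simp only [id]
    field_simp
    ring

lemma deriv01_eq_of_hasDerivAt {u : ℝ → ℝ} {u' r : ℝ} (hu : HasDerivAt u u' r)
    (hr : r ∈ Icc (0:ℝ) 1) : deriv01 u r = u' :=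
  hu.hasDerivWithinAt.derivWithin (uniqueDiffOn_Icc one_pos r hr)

lemma deriv01_radialProfile (hp : 2 < p) (hh : Continuous h) (d : ℝ) {r : ℝ}
    (hr : r ∈ Icc (0:ℝ) 1) : deriv01 (radialProfile p N h d) r = -(radialSlope p N h r) :=
  deriv01_eq_of_hasDerivAt (hasDerivAt_radialProfile hp hh d r) hr

lemma phi_deriv01_radialProfile (hp : 2 < p) (hh : Continuous h) (hh0 : ∀ t, 0 ≤ h t) (d : ℝ)
    {r : ℝ} (hr : r ∈ Icc (0:ℝ) 1) :
    phi p (deriv01 (radialProfile p N h d) r) = -(r * radialMean N h r) := by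
  rw [deriv01_radialProfile hp hh d hr, phi_neg_of_nonneg hp (radialSlope_nonneg hh0 hr.1),
    radialSlope_rpow hp hh0 hr.1]

lemma isSolutionP_radialProfile {f : ℝ → ℝ → ℝ} (hp : 2 < p) (hN : 1 ≤ N) (hh : Continuous h)
    (hh0 : ∀ t, 0 ≤ h t) {d : ℝ}
    (hf : ∀ r ∈ Icc (0:ℝ) 1, h r = f r (radialProfile p N h d r))
    (h1 : radialProfile p N h d 1 = 0) : IsSolutionP p N f 1 (radialProfile p N h d) := by
  have hflow := radialFlow_radialProfile hp hN hh hh0 d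
  have hd : ∀ r ∈ Icc (0:ℝ) 1, HasDerivWithinAt
      (fun s => phi p (deriv01 (radialProfile p N h d) s))
      (-(h r - (N - 1) * radialMean N h r)) (Icc 0 1) r := fun r hr =>
    (hasDerivAt_mul_radialMean hN hh hr.1).neg.hasDerivWithinAt.congr
      (fun s hs => phi_deriv01_radialProfile hp hh hh0 d hs)
      (phi_deriv01_radialProfile hp hh hh0 d hr)
  refine ⟨⟨fun r _ => (hasDerivAt_radialProfile hp hh d r).differentiableAt.differentiableWithinAt,
    ?_⟩, ⟨fun r hr => (hd r hr).differentiableWithinAt, ?_⟩, ?_, ?_, h1⟩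
  · exact (continuous_radialSlope hp hh).neg.continuousOn.congr
      fun r hr => deriv01_radialProfile hp hh d hr
  · refine ContinuousOn.congr (f := fun r => -(h r - (N - 1) * radialMean N h r)) ?_
      fun r hr => (hd r hr).derivWithin (uniqueDiffOn_Icc one_pos r hr)
    exact (hh.sub (continuous_const.mul (continuous_radialMean hh))).neg.continuousOn
  · intro r hr
    rw [one_mul, ← hf r ⟨hr.1.le, hr.2.le⟩]
    refine (hflow.hasDeriv_flux r hr).neg.congr_of_eventuallyEq ?_
    filter_upwards [Icc_mem_nhds hr.1 hr.2] with s hs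
    rw [phi_deriv01_radialProfile hp hh hh0 d hs, Pi.neg_apply, radialSlope_rpow hp hh0 hs.1]
    ring
  · rw [deriv01_radialProfile hp hh d (left_mem_Icc.2 zero_le_one), hflow.slope_zero, neg_zero]

end Profile

section Contraction

variable {p : ℝ} {N : ℕ}

lemma abs_radialMean_sub_le {h₁ h₂ : ℝ → ℝ} (hh₁ : Continuous h₁) (hh₂ : Continuous h₂)
    {A K s : ℝ} (hA : 0 ≤ A) (hK : 0 ≤ K) (hs : s ∈ Icc (0:ℝ) 1)
    (hle : ∀ t ∈ Icc (0:ℝ) 1, |h₁ t - h₂ t| ≤ A * Real.exp (K * t)) :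
    |radialMean N h₁ s - radialMean N h₂ s| ≤ A * Real.exp (K * s) := by
  rw [radialMean, radialMean, ← intervalIntegral.integral_sub
    (Continuous.intervalIntegrable (by fun_prop) _ _)
    (Continuous.intervalIntegrable (by fun_prop) _ _), ← Real.norm_eq_abs]
  have := intervalIntegral.norm_integral_le_of_norm_le_const (a := 0) (b := 1)
    (f := fun τ => τ ^ (N - 1) * h₁ (τ * s) - τ ^ (N - 1) * h₂ (τ * s))
    (C := A * Real.exp (K * s)) (fun τ hτ => by
      rw [uIoc_of_le zero_le_one] at hτ
      have hτs : τ * s ≤ s := mul_le_of_le_one_left hs.1 hτ.2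
      rw [← mul_sub, Real.norm_eq_abs, abs_mul, abs_of_nonneg (pow_nonneg hτ.1.le _)]
      refine (mul_le_of_le_one_left (abs_nonneg _) (pow_le_one₀ hτ.1.le hτ.2)).trans ?_
      refine (hle _ ⟨mul_nonneg hτ.1.le hs.1, hτs.trans hs.2⟩).trans ?_
      exact mul_le_mul_of_nonneg_left
        (Real.exp_le_exp.2 (mul_le_mul_of_nonneg_left hτs hK)) hA)
  simpa using this

lemma le_radialMean {h : ℝ → ℝ} (hN : 1 ≤ N) (hh : Continuous h) (hh0 : ∀ t, 0 ≤ h t) {δ m s : ℝ}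
    (hδ : 0 < δ) (hδ1 : δ ≤ 1) (hs : s ∈ Icc (0:ℝ) 1) (hm : ∀ t ∈ Icc 0 δ, m ≤ h t) :
    m * δ ^ N / N ≤ radialMean N h s := by
  have hcont : Continuous fun τ => τ ^ (N - 1) * h (τ * s) := by fun_prop
  have h1 : ∫ τ in (0:ℝ)..δ, τ ^ (N - 1) * m ≤ ∫ τ in (0:ℝ)..δ, τ ^ (N - 1) * h (τ * s) := by
    refine intervalIntegral.integral_mono_on hδ.le
      (Continuous.intervalIntegrable (by fun_prop) _ _) (hcont.intervalIntegrable _ _) ?_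
    intro τ hτ
    exact mul_le_mul_of_nonneg_left (hm _ ⟨mul_nonneg hτ.1 hs.1,
      (mul_le_of_le_one_right hτ.1 hs.2).trans hτ.2⟩) (pow_nonneg hτ.1 _)
  have h2 : 0 ≤ ∫ τ in δ..1, τ ^ (N - 1) * h (τ * s) :=
    intervalIntegral.integral_nonneg hδ1 fun τ hτ =>
      mul_nonneg (pow_nonneg (hδ.le.trans hτ.1) _) (hh0 _)
  have h3 := intervalIntegral.integral_add_adjacent_intervals
    (hcont.intervalIntegrable 0 δ) (hcont.intervalIntegrable δ 1) (μ := volume)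
  have h4 : ∫ τ in (0:ℝ)..δ, τ ^ (N - 1) * m = m * δ ^ N / N := by
    rw [intervalIntegral.integral_mul_const, integral_pow, Nat.sub_add_cancel hN,
      Nat.cast_sub hN, Nat.cast_one, sub_add_cancel, zero_pow (by omega)]
    ring
  rw [radialMean]
  linarith

lemma abs_rpow_sub_rpow_le {θ c x y : ℝ} (hθ : 0 ≤ θ) (hθ1 : θ ≤ 1) (hc : 0 < c) (hx : c ≤ x)
    (hy : c ≤ y) : |x ^ θ - y ^ θ| ≤ θ * c ^ (θ - 1) * |x - y| := by
  refine Convex.norm_image_sub_le_of_norm_hasDerivWithin_le (s := Ici c)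
    (f := fun t => t ^ θ) (f' := fun t => θ * t ^ (θ - 1)) (fun t ht => ?_) (fun t ht => ?_)
    (convex_Ici c) hy hx
  · exact (Real.hasDerivAt_rpow_const (Or.inl (hc.trans_le ht).ne')).hasDerivWithinAt
  · rw [Real.norm_eq_abs, abs_of_nonneg
      (mul_nonneg hθ (Real.rpow_nonneg (hc.trans_le ht).le _))]
    exact mul_le_mul_of_nonneg_left (Real.rpow_le_rpow_of_nonpos hc ht (by linarith)) hθ

lemma abs_radialSlope_sub_le (hp : 2 < p) {h₁ h₂ : ℝ → ℝ} {c s : ℝ} (hc : 0 < c)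
    (hs : s ∈ Icc (0:ℝ) 1) (h1 : c ≤ radialMean N h₁ s) (h2 : c ≤ radialMean N h₂ s) :
    |radialSlope p N h₁ s - radialSlope p N h₂ s| ≤
      c ^ (1 / (p - 1) - 1) * |radialMean N h₁ s - radialMean N h₂ s| := by
  have hp1 : 0 < p - 1 := by linarith
  have hθ : 0 ≤ 1 / (p - 1) := by positivity
  have hθ1 : 1 / (p - 1) ≤ 1 := by rw [div_le_one hp1]; linarith
  rw [radialSlope, radialSlope, Real.mul_rpow hs.1 (hc.le.trans h1),
    Real.mul_rpow hs.1 (hc.le.trans h2), ← mul_sub, abs_mul,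
    abs_of_nonneg (Real.rpow_nonneg hs.1 _)]
  refine (mul_le_of_le_one_left (abs_nonneg _) (Real.rpow_le_one hs.1 hs.2 hθ)).trans ?_
  refine (abs_rpow_sub_rpow_le hθ hθ1 hc h1 h2).trans ?_
  refine mul_le_mul_of_nonneg_right ?_ (abs_nonneg _)
  exact mul_le_of_le_one_left (Real.rpow_nonneg hc.le _) hθ1

lemma abs_radialProfile_sub_le (hp : 2 < p) {h₁ h₂ : ℝ → ℝ} (hh₁ : Continuous h₁)
    (hh₂ : Continuous h₂) {c A K r d₁ d₂ : ℝ} (hc : 0 < c)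
    (hc₁ : ∀ s ∈ Icc (0:ℝ) 1, c ≤ radialMean N h₁ s)
    (hc₂ : ∀ s ∈ Icc (0:ℝ) 1, c ≤ radialMean N h₂ s)
    (hA : 0 ≤ A) (hK : 0 < K) (hr : r ∈ Icc (0:ℝ) 1)
    (hle : ∀ t ∈ Icc (0:ℝ) 1, |h₁ t - h₂ t| ≤ A * Real.exp (K * t)) :
    |radialProfile p N h₁ d₁ r - radialProfile p N h₂ d₂ r| ≤
      |d₁ - d₂| + c ^ (1 / (p - 1) - 1) * A / K * Real.exp (K * r) := by
  have hcont₁ := continuous_radialSlope (N := N) hp hh₁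
  have hcont₂ := continuous_radialSlope (N := N) hp hh₂
  have e : radialProfile p N h₁ d₁ r - radialProfile p N h₂ d₂ r = (d₁ - d₂) -
      ∫ s in (0:ℝ)..r, (radialSlope p N h₁ s - radialSlope p N h₂ s) := by
    rw [intervalIntegral.integral_sub (hcont₁.intervalIntegrable _ _)
      (hcont₂.intervalIntegrable _ _), radialProfile, radialProfile]
    ring
  rw [e]
  refine (abs_sub _ _).trans (add_le_add le_rfl ?_)
  have hint : ∫ s in (0:ℝ)..r, c ^ (1 / (p - 1) - 1) * A * Real.exp (K * s) =
      c ^ (1 / (p - 1) - 1) * A / K * (Real.exp (K * r) - 1) := by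
    rw [intervalIntegral.integral_const_mul, intervalIntegral.integral_comp_mul_left _ hK.ne',
      integral_exp, mul_zero, Real.exp_zero, smul_eq_mul]
    field_simp
  have h1 := intervalIntegral.norm_integral_le_of_norm_le (a := 0) (b := r) (μ := volume)
    (f := fun s => radialSlope p N h₁ s - radialSlope p N h₂ s)
    (g := fun s => c ^ (1 / (p - 1) - 1) * A * Real.exp (K * s)) hr.1
    (Eventually.of_forall fun s hs => by
      have hs' : s ∈ Icc (0:ℝ) 1 := ⟨hs.1.le, hs.2.trans hr.2⟩
      rw [mul_assoc]
      exact (abs_radialSlope_sub_le hp hc hs' (hc₁ s hs') (hc₂ s hs')).trans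
        (mul_le_mul_of_nonneg_left (abs_radialMean_sub_le hh₁ hh₂ hA hK.le hs' hle)
          (Real.rpow_nonneg hc.le _)))
    (Continuous.intervalIntegrable (by fun_prop) _ _)
  rw [hint, Real.norm_eq_abs] at h1
  refine h1.trans (mul_le_mul_of_nonneg_left (by linarith) ?_)
  have := Real.rpow_nonneg hc.le (1 / (p - 1) - 1)
  positivity

/-- Solvability of the radial initial value problem for a Lipschitz nonlinearity that is bounded
below near the centre, with continuous dependence of the terminal value on the central value. -/
lemma exists_radial_ivp_family (hp : 2 < p) (hN : 1 ≤ N) {F : ℝ → ℝ → ℝ}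
    (hF : Continuous (Function.uncurry F)) (hF0 : ∀ t ξ, 0 ≤ F t ξ) {L δ m : ℝ} (hL : 0 ≤ L)
    (hLip : ∀ t ∈ Icc (0:ℝ) 1, ∀ ξ η, |F t ξ - F t η| ≤ L * |ξ - η|) (hδ : 0 < δ) (hδ1 : δ ≤ 1)
    (hm : 0 < m) (hFm : ∀ t ∈ Icc 0 δ, ∀ ξ, m ≤ F t ξ) :
    ∃ h : ℝ → ℝ → ℝ, (∀ d, Continuous (h d)) ∧ (∀ d t, 0 ≤ h d t) ∧
      (∀ d, ∀ t ∈ Icc (0:ℝ) 1, h d t = F t (radialProfile p N (h d) d t)) ∧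
      Continuous fun d => radialProfile p N (h d) d 1 := by
  have hN1 : (1 : ℝ) ≤ N := by exact_mod_cast hN
  have hN0 : (0 : ℝ) < N := by linarith
  obtain ⟨c, hcdef⟩ : ∃ c, c = m * δ ^ N / N := ⟨_, rfl⟩
  have hc : 0 < c := by rw [hcdef]; positivity
  obtain ⟨D, hDdef⟩ : ∃ D, D = c ^ (1 / (p - 1) - 1) := ⟨_, rfl⟩
  have hD : 0 ≤ D := by rw [hDdef]; exact Real.rpow_nonneg hc.le _
  obtain ⟨K, hKdef⟩ : ∃ K, K = 2 * (D * L) + 1 := ⟨_, rfl⟩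
  have hK : 0 < K := by rw [hKdef]; positivity
  have hDLK : D * L / K ≤ 1 / 2 := by
    rw [div_le_iff₀ hK, hKdef]; linarith
  obtain ⟨src, hsrc⟩ : ∃ src : C(Icc (0:ℝ) 1, ℝ) → ℝ → ℝ, src =
      fun (v : C(Icc (0:ℝ) 1, ℝ)) (t : ℝ) =>
        F t (Real.exp (K * t) * IccExtend (zero_le_one' ℝ) (⇑v) t) := ⟨_, rfl⟩
  have hsrc_cont : ∀ v, Continuous (src v) := by
    intro v
    have hv : Continuous (IccExtend (zero_le_one' ℝ) v) := v.continuous.Icc_extend'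
    rw [hsrc]
    exact hF.comp (continuous_id.prodMk (by fun_prop))
  have hsrc_nonneg : ∀ v t, 0 ≤ src v t := by
    intro v t; rw [hsrc]; exact hF0 _ _
  have hsrc_mean : ∀ v, ∀ s ∈ Icc (0:ℝ) 1, c ≤ radialMean N (src v) s := by
    intro v s hs
    rw [hcdef]
    refine le_radialMean hN (hsrc_cont v) (hsrc_nonneg v) hδ hδ1 hs fun t ht => ?_
    rw [hsrc]
    exact hFm t ht _
  have hsrc_sub : ∀ v w : C(Icc (0:ℝ) 1, ℝ), ∀ t ∈ Icc (0:ℝ) 1,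
      |src v t - src w t| ≤ L * dist v w * Real.exp (K * t) := by
    intro v w t ht
    rw [hsrc]
    refine (hLip t ht _ _).trans ?_
    rw [← mul_sub, abs_mul, abs_of_pos (Real.exp_pos _), IccExtend_of_mem _ _ ht,
      IccExtend_of_mem _ _ ht, ← Real.dist_eq]
    have := mul_le_mul_of_nonneg_left (ContinuousMap.dist_apply_le_dist (f := v) (g := w) ⟨t, ht⟩)
      (Real.exp_pos (K * t)).le
    calc _ ≤ L * (Real.exp (K * t) * dist v w) := mul_le_mul_of_nonneg_left this hL
      _ = _ := by ring
  obtain ⟨T, hT⟩ : ∃ T : ℝ → C(Icc (0:ℝ) 1, ℝ) → C(Icc (0:ℝ) 1, ℝ), ∀ d v r,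
      T d v r = Real.exp (-(K * r)) * radialProfile p N (src v) d r := by
    have hcont : ∀ d v, Continuous (radialProfile p N (src v) d) := fun d v =>
      continuous_iff_continuousAt.2 fun r =>
        (hasDerivAt_radialProfile hp (hsrc_cont v) d r).continuousAt
    exact ⟨fun d v => ⟨fun r => Real.exp (-(K * r)) * radialProfile p N (src v) d r,
      (by fun_prop : Continuous fun r : Icc (0:ℝ) 1 => Real.exp (-(K * (r:ℝ)))).mul
        ((hcont d v).comp continuous_subtype_val)⟩, fun d v r => rfl⟩
  have hTdist : ∀ d₁ d₂ v w, dist (T d₁ v) (T d₂ w) ≤ |d₁ - d₂| + 1 / 2 * dist v w := by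
    intro d₁ d₂ v w
    have hvw : 0 ≤ dist v w := dist_nonneg
    refine (ContinuousMap.dist_le (by positivity)).2 fun r => ?_
    have h1 := abs_radialProfile_sub_le hp (hsrc_cont v) (hsrc_cont w) hc (hsrc_mean v)
      (hsrc_mean w) (mul_nonneg hL hvw) hK r.2 (d₁ := d₁) (d₂ := d₂) (hsrc_sub v w)
    rw [hT, hT, Real.dist_eq, ← mul_sub, abs_mul, abs_of_pos (Real.exp_pos _)]
    rw [← hDdef] at h1
    have hexp : Real.exp (-(K * r)) * Real.exp (K * r) = 1 := by
      rw [← Real.exp_add]; simp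
    have hexp1 : Real.exp (-(K * (r:ℝ))) ≤ 1 :=
      Real.exp_le_one_iff.2 (neg_nonpos.2 (mul_nonneg hK.le r.2.1))
    calc _ ≤ Real.exp (-(K * r)) *
          (|d₁ - d₂| + D * (L * dist v w) / K * Real.exp (K * r)) :=
          mul_le_mul_of_nonneg_left h1 (Real.exp_pos _).le
      _ = Real.exp (-(K * r)) * |d₁ - d₂| + D * L / K * dist v w *
          (Real.exp (-(K * r)) * Real.exp (K * r)) := by ring
      _ ≤ 1 * |d₁ - d₂| + 1 / 2 * dist v w := by
          rw [hexp, mul_one]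
          exact add_le_add (mul_le_mul_of_nonneg_right hexp1 (abs_nonneg _))
            (mul_le_mul_of_nonneg_right hDLK hvw)
      _ = _ := by rw [one_mul]
  have hcontr : ∀ d, ContractingWith (1 / 2) (T d) := by
    intro d
    refine ⟨by rw [← NNReal.coe_lt_coe]; norm_num, LipschitzWith.of_dist_le_mul fun v w => ?_⟩
    have := hTdist d d v w
    simpa using this
  obtain ⟨fp, hfp⟩ : ∃ fp : ℝ → C(Icc (0:ℝ) 1, ℝ), ∀ d, T d (fp d) = fp d :=
    ⟨fun d => ContractingWith.fixedPoint (T d) (hcontr d),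
      fun d => (hcontr d).fixedPoint_isFixedPt⟩
  have hprof : ∀ d, ∀ r : Icc (0:ℝ) 1,
      Real.exp (K * r) * fp d r = radialProfile p N (src (fp d)) d r := by
    intro d r
    have h1 := hT d (fp d) r
    rw [hfp] at h1
    rw [h1, ← mul_assoc, ← Real.exp_add, add_neg_cancel, Real.exp_zero, one_mul]
  refine ⟨fun d => src (fp d), fun d => hsrc_cont _, fun d => hsrc_nonneg _, fun d t ht => ?_, ?_⟩
  · rw [← hprof d ⟨t, ht⟩]
    conv_lhs => rw [hsrc]
    simp only [IccExtend_of_mem _ _ ht]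
  · have hlip : LipschitzWith 2 fp := by
      refine LipschitzWith.of_dist_le_mul fun d₁ d₂ => ?_
      have := hTdist d₁ d₂ (fp d₁) (fp d₂)
      rw [hfp, hfp] at this
      rw [Real.dist_eq d₁ d₂]
      push_cast
      linarith
    have hcont : Continuous fun d => Real.exp (K * 1) * fp d ⟨1, right_mem_Icc.2 zero_le_one⟩ :=
      continuous_const.mul ((continuous_eval_const _).comp hlip.continuous)
    exact hcont.congr fun d => hprof d ⟨1, right_mem_Icc.2 zero_le_one⟩

end Contraction

section Shooting

variable {p : ℝ} {N : ℕ} {f f₂ : ℝ → ℝ → ℝ} {f0 finf : ℝ → ℝ}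

lemma HypH.exists_lipschitz (H : HypH p N f f₂ f0 finf) (M : ℝ) :
    ∃ L ≥ 0, ∀ t ∈ Icc (0:ℝ) 1, ∀ ξ ∈ Icc 0 M, ∀ η ∈ Icc 0 M,
      |f t ξ - f t η| ≤ L * |ξ - η| := by
  obtain ⟨L, hL⟩ := (isCompact_Icc.prod isCompact_Icc).exists_bound_of_continuousOn
    (H.hf₂_cont.mono (prod_mono_right (subset_univ (Icc 0 M))))
  refine ⟨max L 0, le_max_right _ _, fun t ht ξ hξ η hη => ?_⟩
  exact Convex.norm_image_sub_le_of_norm_hasDerivWithin_le (f := f t) (f' := f₂ t)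
    (fun x _ => (H.hf_deriv t ht x).hasDerivWithinAt)
    (fun x hx => (hL (t, x) ⟨ht, hx⟩).trans (le_max_left _ _)) (convex_Icc 0 M) hη hξ

lemma HypH.exists_pos_lower_bound (H : HypH p N f f₂ f0 finf) {a b : ℝ} (ha : 0 < a)
    (hab : a ≤ b) : ∃ m > 0, ∀ t ∈ Icc (0:ℝ) 1, ∀ ξ ∈ Icc a b, m ≤ f t ξ := by
  obtain ⟨x, hx, hmin⟩ := (isCompact_Icc.prod isCompact_Icc).exists_isMinOn
    ((nonempty_Icc.2 (zero_le_one' ℝ)).prod (nonempty_Icc.2 hab))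
    (H.hf_cont.mono (prod_mono_right (subset_univ (Icc a b))))
  exact ⟨f x.1 x.2, H.hH2 _ hx.1 _ (ha.trans_le hx.2.1).ne',
    fun t ht ξ hξ => hmin (show (t, ξ) ∈ Icc (0:ℝ) 1 ×ˢ Icc a b from ⟨ht, hξ⟩)⟩

/-- A family of solutions of the initial value problem for `f r (max u 0)` with central values in
`[d₁, d₂]` and continuous terminal value. -/
lemma HypH.exists_shooting_family (H : HypH p N f f₂ f0 finf) {d₁ d₂ : ℝ} (hd₁ : 0 < d₁)
    (hd : d₁ ≤ d₂) :
    ∃ h : ℝ → ℝ → ℝ, (∀ d, Continuous (h d)) ∧ (∀ d t, 0 ≤ h d t) ∧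
      (∀ d ∈ Icc d₁ d₂, ∀ t ∈ Icc (0:ℝ) 1,
        h d t = f t (max (radialProfile p N (h d) d t) 0)) ∧
      Continuous fun d => radialProfile p N (h d) d 1 := by
  have hp := H.hp
  have hd₂ : 0 < d₂ := hd₁.trans_le hd
  obtain ⟨K, hK1, hK⟩ := H.exists_growth
  have hC : 0 < K * d₂ := by positivity
  obtain ⟨C, hCdef⟩ : ∃ C, C = K * d₂ := ⟨_, rfl⟩
  rw [← hCdef] at hC
  obtain ⟨clamp, hclamp⟩ : ∃ clamp : ℝ → ℝ → ℝ, clamp = fun t ξ =>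
      max (max 0 (d₁ - C * t)) (min ξ d₂) := ⟨_, rfl⟩
  have hclamp_mem : ∀ t, 0 ≤ t → ∀ ξ, clamp t ξ ∈ Icc 0 d₂ := by
    intro t ht ξ
    have := mul_nonneg hC.le ht
    rw [hclamp]
    exact ⟨(le_max_left _ _).trans (le_max_left _ _),
      max_le (max_le hd₂.le (by linarith)) (min_le_right _ _)⟩
  obtain ⟨L, hL, hLip⟩ := H.exists_lipschitz d₂
  obtain ⟨m, hm, hfm⟩ := H.exists_pos_lower_bound (half_pos hd₁) (by linarith : d₁ / 2 ≤ d₂)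
  obtain ⟨F, hFdef⟩ : ∃ F : ℝ → ℝ → ℝ, F = fun t ξ =>
      f (projIcc 0 1 (zero_le_one' ℝ) t) (clamp t ξ) := ⟨_, rfl⟩
  have hFeq : ∀ t ∈ Icc (0:ℝ) 1, ∀ ξ, F t ξ = f t (clamp t ξ) := by
    intro t ht ξ
    rw [hFdef]
    simp only [projIcc_of_mem (zero_le_one' ℝ) ht]
  have hFcont : Continuous (Function.uncurry F) := by
    have h1 : Continuous fun x : ℝ × ℝ =>
        (((projIcc 0 1 (zero_le_one' ℝ) x.1 : Icc (0:ℝ) 1) : ℝ), clamp x.1 x.2) := by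
      rw [hclamp]
      exact (continuous_subtype_val.comp (continuous_projIcc.comp continuous_fst)).prodMk
        (by fun_prop)
    rw [hFdef]
    exact H.hf_cont.comp_continuous h1 fun x => ⟨Subtype.coe_prop _, mem_univ _⟩
  have hF0 : ∀ t ξ, 0 ≤ F t ξ := by
    intro t ξ
    rw [hFdef]
    exact H.nonneg (Subtype.coe_prop _) _
  have hFLip : ∀ t ∈ Icc (0:ℝ) 1, ∀ ξ η, |F t ξ - F t η| ≤ L * |ξ - η| := by
    intro t ht ξ η
    rw [hFeq t ht, hFeq t ht]
    refine (hLip t ht _ (hclamp_mem t ht.1 ξ) _ (hclamp_mem t ht.1 η)).trans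
      (mul_le_mul_of_nonneg_left ?_ hL)
    rw [hclamp]
    refine (abs_max_sub_max_le_max _ _ _ _).trans ?_
    rw [sub_self, abs_zero, max_eq_right (abs_nonneg _)]
    refine (abs_min_sub_min_le_max _ _ _ _).trans ?_
    rw [sub_self, abs_zero, max_eq_left (abs_nonneg _)]
  have hδ : 0 < min 1 (d₁ / (2 * C)) := lt_min one_pos (by positivity)
  have hFm : ∀ t ∈ Icc 0 (min 1 (d₁ / (2 * C))), ∀ ξ, m ≤ F t ξ := by
    intro t ht ξ
    have ht1 : t ∈ Icc (0:ℝ) 1 := ⟨ht.1, ht.2.trans (min_le_left _ _)⟩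
    have ht2 := ht.2.trans (min_le_right _ _)
    rw [le_div_iff₀ (by positivity)] at ht2
    rw [hFeq t ht1]
    refine hfm t ht1 _ ⟨?_, (hclamp_mem t ht.1 ξ).2⟩
    rw [hclamp]
    exact le_max_of_le_left (le_max_of_le_right (by linarith))
  obtain ⟨h, hh, hh0, hhF, hcont⟩ := exists_radial_ivp_family hp H.hN hFcont hF0 hL hFLip hδ
    (min_le_left _ _) hm hFm
  refine ⟨h, hh, hh0, fun d hd' t ht => ?_, hcont⟩
  rw [hhF d t ht, hFeq t ht]
  have hflow := radialFlow_radialProfile hp H.hN (hh d) (hh0 d) d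
  have h0 : radialProfile p N (h d) d 0 = d := by simp [radialProfile]
  have hupper := hflow.antitoneOn (left_mem_Icc.2 zero_le_one) ht ht.1
  rw [h0] at hupper
  have hlower := hflow.sub_mul_le hp H.hN hC.le (fun r hr => by
    have hr' : r ∈ Icc (0:ℝ) 1 := ⟨hr.1.le, hr.2.le⟩
    rw [hhF d r hr', hFeq r hr']
    have hmem := hclamp_mem r hr.1.le (radialProfile p N (h d) d r)
    refine (hK r hr' _ hmem.1).trans ?_
    rw [hCdef, Real.mul_rpow (by linarith) hd₂.le]
    exact mul_le_mul (Real.self_le_rpow_of_one_le hK1 (by linarith))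
      (Real.rpow_le_rpow hmem.1 hmem.2 (by linarith)) (Real.rpow_nonneg hmem.1 _)
      (Real.rpow_nonneg (by linarith) _)) ht
  rw [h0] at hlower
  congr 1
  rw [hclamp]
  simp only
  rw [min_eq_left (hupper.trans hd'.2), max_assoc, max_eq_right (a := d₁ - C * t)
    (by linarith [hd'.1]), max_comm]

lemma RadialFlow.congr_source {u q g g' : ℝ → ℝ} (h : RadialFlow p N u q g)
    (hg : ∀ r ∈ Ioo (0:ℝ) 1, g r = g' r) : RadialFlow p N u q g' :=
  { h with hasDeriv_flux := fun r hr => hg r hr ▸ h.hasDeriv_flux r hr }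

lemma IsSolutionP.radialFlow (H : HypH p N f f₂ f0 finf) {u : ℝ → ℝ}
    (hu : IsSolutionP p N f 1 u) :
    RadialFlow p N u (fun r => -(deriv01 u r)) (fun r => f r (u r)) :=
  hu.1.radialFlow H.hp (fun r hr => by simpa using hu.2.2.1 r hr) hu.2.2.2.1
    fun r hr => H.nonneg ⟨hr.1.le, hr.2.le⟩ _

lemma IsSolutionP.pos (H : HypH p N f f₂ f0 finf) {u : ℝ → ℝ} (hu : IsSolutionP p N f 1 u)
    (hne : Nontriv01 u) : ∀ r ∈ Ico (0:ℝ) 1, 0 < u r := by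
  have hflow := hu.radialFlow H
  have hu1 : u 1 = 0 := hu.2.2.2.2
  obtain ⟨s, hs, hus⟩ := hne
  have h1 := hflow.antitoneOn hs (right_mem_Icc.2 zero_le_one) hs.2
  have h0 := hflow.antitoneOn (left_mem_Icc.2 zero_le_one) hs hs.1
  rw [hu1] at h1
  exact fun r hr => hflow.pos H.hp (fun r hr => H.nonneg ⟨hr.1.le, hr.2.le⟩ _)
    ((lt_of_le_of_ne h1 hus.symm).trans_le h0) hu1 hr

lemma HypH.exists_solution (H : HypH p N f f₂ f0 finf) {d₀ D : ℝ} (hd₀ : 0 < d₀) (hD : 0 < D)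
    (hsmall : ∀ u q, RadialFlow p N u q (fun r => f r (max (u r) 0)) → u 0 < d₀ → u 1 ≤ 0)
    (hlarge : ∀ u q, RadialFlow p N u q (fun r => f r (max (u r) 0)) → D ≤ u 0 → 0 ≤ u 1) :
    ∃ u, IsSolutionP p N f 1 u ∧ Nontriv01 u := by
  have hp := H.hp
  have hd₁ : 0 < min (d₀ / 2) D := lt_min (by linarith) hD
  have hle : min (d₀ / 2) D ≤ D := min_le_right _ _
  obtain ⟨h, hh, hh0, hhf, hcont⟩ := H.exists_shooting_family hd₁ hle
  have hflow := fun d => radialFlow_radialProfile hp H.hN (hh d) (hh0 d) d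
  have hu0 : ∀ d, radialProfile p N (h d) d 0 = d := by simp [radialProfile]
  have hflow' := fun d hd => (hflow d).congr_source
    fun r hr => hhf d hd r ⟨hr.1.le, hr.2.le⟩
  have hl := hsmall _ _ (hflow' _ (left_mem_Icc.2 hle)) (by
    rw [hu0]
    exact (min_le_left _ _).trans_lt (by linarith))
  have hr := hlarge _ _ (hflow' _ (right_mem_Icc.2 hle)) (by rw [hu0])
  obtain ⟨d, hd, hd0⟩ := intermediate_value_Icc hle hcont.continuousOn ⟨hl, hr⟩
  simp only at hd0
  refine ⟨radialProfile p N (h d) d,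
    isSolutionP_radialProfile hp H.hN (hh d) (hh0 d) (fun r hr => ?_) hd0,
    0, left_mem_Icc.2 zero_le_one, ?_⟩
  · have := (hflow d).antitoneOn hr (right_mem_Icc.2 zero_le_one) hr.2
    rw [hd0] at this
    conv_lhs => rw [hhf d hd r hr, max_eq_left this]
  · rw [hu0]
    exact (hd₁.trans_le hd.1).ne'

end Shooting

/-- under (H), if `λ₀ < 1 < λ∞`, the problem
`-(r^(N-1) φ_p(u'))' = r^(N-1) f(r,u)`, `u'(0) = u(1) = 0`, has exactly one nontrivial
solution, and it is positive on `[0,1)`. -/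
theorem stmt_19 (p : ℝ) (N : ℕ) (f f₂ : ℝ → ℝ → ℝ) (f0 finf : ℝ → ℝ)
    (H : HypH p N f f₂ f0 finf)
    (lam0 : ℝ) (hlam0 : ∃ v, IsPrincipalEigenpair p N f0 lam0 v)
    (hlam0_lt : lam0 < 1)
    (hinf : (∃ lamInf : ℝ, (∃ v, IsPrincipalEigenpair p N finf lamInf v) ∧ 1 < lamInf) ∨
            (N = 1 ∧ ∀ r ∈ Set.Icc (0:ℝ) 1, finf r = 0)) :
    ∃ u : ℝ → ℝ,
      IsSolutionP p N f 1 u ∧ Nontriv01 u ∧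
      (∀ r ∈ Set.Ico (0:ℝ) 1, 0 < u r) ∧
      ∀ u' : ℝ → ℝ, IsSolutionP p N f 1 u' → Nontriv01 u' →
        Set.EqOn u' u (Set.Icc 0 1) := by
  obtain ⟨d₀, hd₀, hsmall⟩ := exists_small_shooting H hlam0 hlam0_lt
  obtain ⟨D, hD, hlarge⟩ : ∃ D > 0, ∀ u q,
      RadialFlow p N u q (fun r => f r (max (u r) 0)) → D ≤ u 0 → 0 ≤ u 1 := by
    rcases H.hH6 with hpos | ⟨-, hzero⟩
    · rcases hinf with ⟨lamInf, hlamInf, hlt⟩ | ⟨-, hzero⟩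
      · exact exists_large_shooting_of_eigenpair H hpos hlamInf hlt
      · exact exists_large_shooting_of_zero H hzero
    · exact exists_large_shooting_of_zero H hzero
  obtain ⟨u, hu, hne⟩ := H.exists_solution hd₀ hD hsmall hlarge
  refine ⟨u, hu, hne, hu.pos H hne, fun w hw hwne => ?_⟩
  exact H.positive_unique (hw.radialFlow H) (hu.radialFlow H) (hw.pos H hwne) hw.2.2.2.2
    (hu.pos H hne) hu.2.2.2.2
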